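/- arXiv:2207.11587 — 5 statements merged into one kernel-verified Lean document; each statement's English description precedes it below -/
import Mathlib

section
/- There exist a compact metrizable space X and a uniform algebra B on X such that there is a nonzero bounded point derivation on B at some character of B, yet every Gleason part of B is a single point (equivalently, ‖φ − ψ‖ = 2 in the dual norm for all distinct characters φ, ψ of B). -/
open WeakDual Topology

set_option synthInstance.maxHeartbeats 400000
set_option maxHeartbeats 1000000
set_option linter.unusedSectionVars false

noncomputable section

variable {X : Type*} [TopologicalSpace X]

/-- A uniform algebra on `X`: a closed point-separating subalgebra of `C(X, ℂ)`
(it automatically contains the constant functions, being a subalgebra). -/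
def IsUniformAlgebra (A : Subalgebra ℂ C(X, ℂ)) : Prop :=
  IsClosed (A : Set C(X, ℂ)) ∧ ∀ x y : X, x ≠ y → ∃ f ∈ A, f x ≠ f y

/-- The character of evaluation at a point `x ∈ X`. -/
def evalChar (A : Subalgebra ℂ C(X, ℂ)) (x : X) : characterSpace ℂ A :=
  ⟨{ toFun := fun f => (f : C(X, ℂ)) x
     map_add' := fun f g => rfl
     map_smul' := fun c f => rfl
     cont := (ContinuousEvalConst.continuous_eval_const x).comp continuous_subtype_val },
   ⟨by
      intro h
      have h1 : ((1 : A) : C(X, ℂ)) x = 0 := DFunLike.congr_fun h 1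
      simp at h1,
    fun f g => rfl⟩⟩

/-- The continuous linear functional on `A` underlying a character,
as an element of the normed dual of `A`. -/
def charDual {A : Type*} [NonUnitalNonAssocSemiring A] [TopologicalSpace A] [Module ℂ A]
    (φ : characterSpace ℂ A) : A →L[ℂ] ℂ := φ.1

/-- The set `J_φ` of elements of `A` whose Gelfand transform vanishes on a
neighborhood of `φ` in the maximal ideal space of `A`. -/
def vanishNearSet (A : Subalgebra ℂ C(X, ℂ)) (φ : characterSpace ℂ A) : Set A :=
  {f | ∃ U ∈ 𝓝 φ, ∀ ψ ∈ U, ψ f = 0}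

/-- `A` is normal on `X`: disjoint closed sets are separated by a `0`-`1` valued
pair of values of some function in `A`. -/
def IsNormalOn (A : Subalgebra ℂ C(X, ℂ)) : Prop :=
  ∀ K₀ K₁ : Set X, IsClosed K₀ → IsClosed K₁ → Disjoint K₀ K₁ →
    ∃ f ∈ A, (∀ x ∈ K₀, f x = 0) ∧ (∀ x ∈ K₁, f x = 1)

/-- `A` is strongly regular at `x`: `J_x` is dense in `M_x`. -/
def StronglyRegularAt (A : Subalgebra ℂ C(X, ℂ)) (x : X) : Prop :=
  {f : A | (f : C(X, ℂ)) x = 0} ⊆ closure (vanishNearSet A (evalChar A x))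

/-- `d` is a point derivation sequence of order `n` at `φ`: `d⁰ = φ` and the
Leibniz identities hold for `1 ≤ k ≤ n` (linearity/continuity of the `d k` is
imposed by the type at which this is used). -/
def IsDerivSeq {A : Type*} [Mul A] (φ : A → ℂ) (n : ℕ∞) (d : ℕ → A → ℂ) : Prop :=
  (∀ f, d 0 f = φ f) ∧
  ∀ k : ℕ, 1 ≤ k → (k : ℕ∞) ≤ n → ∀ f g,
    d k (f * g) = ∑ j ∈ Finset.range (k + 1), d j f * d (k - j) g

variable [CompactSpace X]

/-- `A` has bounded relative units at `x`. -/
def HasBoundedRelativeUnits (A : Subalgebra ℂ C(X, ℂ)) (x : X) : Prop :=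
  ∃ C : ℝ, 0 < C ∧ ∀ K : Set X, IsCompact K → x ∉ K →
    ∃ f : A, f ∈ vanishNearSet A (evalChar A x) ∧
      (∀ y ∈ K, (f : C(X, ℂ)) y = 1) ∧ ‖(f : C(X, ℂ))‖ ≤ C

/-- `x` is a generalized peak point for `A`. -/
def IsGeneralizedPeakPoint (A : Subalgebra ℂ C(X, ℂ)) (x : X) : Prop :=
  ∀ U ∈ 𝓝 x, ∃ f ∈ A, f x = 1 ∧ ‖f‖ = 1 ∧ ∀ y ∉ U, ‖f y‖ < 1

/-- `P` is a Gleason part for `A`: the set of all characters at dual-norm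
distance `< 2` from some fixed character. -/
def IsGleasonPart (A : Subalgebra ℂ C(X, ℂ)) (P : Set (characterSpace ℂ A)) : Prop :=
  ∃ φ : characterSpace ℂ A, P = {ψ | ‖charDual φ - charDual ψ‖ < 2}

/-- The carrier set of Feinstein's algebra `A_x = cl(J_x) ⊕ ℂ·1`. -/
def feinsteinSet (A : Subalgebra ℂ C(X, ℂ)) (x : X) : Set C(X, ℂ) :=
  {h | ∃ g ∈ closure ((fun f : A => (f : C(X, ℂ))) '' vanishNearSet A (evalChar A x)),
    ∃ c : ℂ, h = g + algebraMap ℂ C(X, ℂ) c}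

/-- The coefficient of the monomial `X 0`, as the partial derivative at the origin. -/
def linCoeff : MvPolynomial ℕ ℂ →ₗ[ℂ] ℂ :=
  (MvPolynomial.aeval (0 : ℕ → ℂ)).toLinearMap ∘ₗ (MvPolynomial.pderiv (R := ℂ) 0).toLinearMap

lemma linCoeff_apply (p : MvPolynomial ℕ ℂ) :
    linCoeff p = MvPolynomial.eval 0 (MvPolynomial.pderiv 0 p) := by
  simp [linCoeff, MvPolynomial.aeval_eq_eval]

lemma linCoeff_mul (p q : MvPolynomial ℕ ℂ) :
    linCoeff (p * q) =
      linCoeff p * MvPolynomial.eval 0 q + MvPolynomial.eval 0 p * linCoeff q := by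
  simp only [linCoeff_apply, Derivation.leibniz, smul_eq_mul, map_add, map_mul]
  ring

lemma linCoeff_X_zero : linCoeff (MvPolynomial.X 0) = 1 := by
  simp [linCoeff_apply]

lemma linCoeff_X_succ (n : ℕ) : linCoeff (MvPolynomial.X (n + 1)) = 0 := by
  simp [linCoeff_apply, MvPolynomial.pderiv_X]

lemma linCoeff_mul_pow {p q : MvPolynomial ℕ ℂ} (h₀ : MvPolynomial.eval 0 q = 0)
    (h₁ : linCoeff q = 0) (k : ℕ) : linCoeff (p * q ^ (k + 1)) = 0 := by
  rw [pow_succ, ← mul_assoc, linCoeff_mul, h₀, h₁]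
  simp

lemma hasDerivAt_eval_single (p : MvPolynomial ℕ ℂ) (w : ℂ) :
    HasDerivAt (fun w : ℂ => MvPolynomial.eval (Pi.single 0 w) p)
      (MvPolynomial.eval (Pi.single 0 w) (MvPolynomial.pderiv 0 p)) w := by
  induction p using MvPolynomial.induction_on with
  | C a => simpa using hasDerivAt_const w a
  | add p q hp hq => simpa using! hp.add hq
  | mul_X p i hp =>
    have hi : HasDerivAt (fun w : ℂ => (Pi.single 0 w : ℕ → ℂ) i)
        (MvPolynomial.eval (Pi.single 0 w)
          (MvPolynomial.pderiv (R := ℂ) 0 (MvPolynomial.X i))) w := by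
      rcases eq_or_ne i 0 with rfl | h
      · simpa using! hasDerivAt_id w
      · simpa [MvPolynomial.pderiv_X, Pi.single_apply, h] using hasDerivAt_const w (0 : ℂ)
    have := hp.mul hi
    simp only [Derivation.leibniz, smul_eq_mul, map_add, map_mul, MvPolynomial.eval_X]
    convert! this using 1
    ring

lemma eval_congr_of_mem_supported {s : Set ℕ} {p : MvPolynomial ℕ ℂ}
    (hp : p ∈ MvPolynomial.supported ℂ s) {z z' : ℕ → ℂ} (h : ∀ i ∈ s, z i = z' i) :
    MvPolynomial.eval z p = MvPolynomial.eval z' p := by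
  rw [MvPolynomial.supported_eq_adjoin_X] at hp
  induction hp using Algebra.adjoin_induction with
  | mem x hx =>
    obtain ⟨i, hi, rfl⟩ := hx
    simpa using h i hi
  | algebraMap r => simp [MvPolynomial.algebraMap_eq]
  | add x y _ _ hx hy => simp [hx, hy]
  | mul x y _ _ hx hy => simp [hx, hy]

/-- Averaging over the two square roots `± y` of `F z` in the coordinate `n + 1` turns a
polynomial in the coordinates `≤ n + 1` into one in the coordinates `≤ n`, with the same
coefficient at `X 0`. -/
lemma exists_average_sqrt {n : ℕ} {F : MvPolynomial ℕ ℂ}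
    (hF : F ∈ MvPolynomial.supported ℂ (Set.Iic n)) (h₀ : MvPolynomial.eval 0 F = 0)
    (h₁ : linCoeff F = 0) {p : MvPolynomial ℕ ℂ}
    (hp : p ∈ MvPolynomial.supported ℂ (Set.Iic (n + 1))) :
    ∃ q ∈ MvPolynomial.supported ℂ (Set.Iic n), linCoeff q = linCoeff p ∧
      ∀ (z : ℕ → ℂ) (y : ℂ), y ^ 2 = MvPolynomial.eval z F →
        2 * MvPolynomial.eval z q = MvPolynomial.eval (Function.update z (n + 1) y) p +
          MvPolynomial.eval (Function.update z (n + 1) (-y)) p := by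
  let P : MvPolynomial ℕ ℂ → Prop := fun p =>
    ∃ q ∈ MvPolynomial.supported ℂ (Set.Iic n), linCoeff q = linCoeff p ∧
      ∀ (z : ℕ → ℂ) (y : ℂ), y ^ 2 = MvPolynomial.eval z F →
        2 * MvPolynomial.eval z q = MvPolynomial.eval (Function.update z (n + 1) y) p +
          MvPolynomial.eval (Function.update z (n + 1) (-y)) p
  have hmul : ∀ h ∈ MvPolynomial.supported ℂ (Set.Iic n), ∀ k : ℕ,
      P (h * MvPolynomial.X (n + 1) ^ k) := by
    intro h hh k
    have hup : ∀ (z : ℕ → ℂ) (y : ℂ),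
        MvPolynomial.eval (Function.update z (n + 1) y) h = MvPolynomial.eval z h := by
      intro z y
      refine eval_congr_of_mem_supported hh fun i hi => ?_
      rw [Function.update_of_ne]
      have : i ≤ n := hi
      omega
    have hX₀ : MvPolynomial.eval 0 (MvPolynomial.X (n + 1) : MvPolynomial ℕ ℂ) = 0 := by simp
    have hX₁ := linCoeff_X_succ n
    rcases Nat.even_or_odd' k with ⟨l, rfl | rfl⟩
    · refine ⟨h * F ^ l, mul_mem hh (pow_mem hF l), ?_, ?_⟩
      · rcases l with _ | l
        · simp
        · rw [linCoeff_mul_pow h₀ h₁, show 2 * (l + 1) = 2 * l + 1 + 1 by ring,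
            linCoeff_mul_pow hX₀ hX₁]
      · intro z y hy
        simp only [map_mul, map_pow, MvPolynomial.eval_X, Function.update_self, hup, pow_mul,
          neg_sq, hy]
        ring
    · refine ⟨0, zero_mem _, ?_, ?_⟩
      · rw [linCoeff_mul_pow hX₀ hX₁, map_zero]
      · intro z y hy
        simp only [map_mul, map_pow, MvPolynomial.eval_X, Function.update_self, hup, pow_succ,
          pow_mul, map_zero]
        ring
  have hadd : ∀ p₁ p₂, P p₁ → P p₂ → P (p₁ + p₂) := by
    rintro p₁ p₂ ⟨q₁, hq₁, hl₁, he₁⟩ ⟨q₂, hq₂, hl₂, he₂⟩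
    refine ⟨q₁ + q₂, add_mem hq₁ hq₂, by simp [hl₁, hl₂], fun z y hy => ?_⟩
    simp only [map_add, mul_add, he₁ z y hy, he₂ z y hy]
    ring
  suffices P p from this
  rw [← MvPolynomial.support_sum_monomial_coeff p]
  refine Finset.sum_induction _ P hadd ?_ ?_
  · simpa using hmul 0 (zero_mem _) 0
  · intro s hs
    have hmon : MvPolynomial.monomial s (p.coeff s) =
        MvPolynomial.monomial (s.erase (n + 1)) (p.coeff s) *
          MvPolynomial.X (n + 1) ^ s (n + 1) := by
      rw [MvPolynomial.X_pow_eq_monomial, MvPolynomial.monomial_mul, mul_one,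
        Finsupp.erase_add_single]
    rw [hmon]
    refine hmul _ ?_ _
    rw [MvPolynomial.mem_supported] at hp ⊢
    rw [MvPolynomial.vars_monomial (MvPolynomial.mem_support_iff.mp hs)]
    intro i hi
    simp only [Finsupp.support_erase, Finset.coe_erase, Set.mem_sdiff, Finset.mem_coe,
      Set.mem_singleton_iff] at hi
    have : i ≤ n + 1 := hp (MvPolynomial.mem_vars_iff_mem_support i |>.mpr ⟨s, hs, hi.1⟩)
    have := hi.2
    simp only [Set.mem_Iic]
    omega

/-- The set of all `z` with `‖z 0‖ ≤ 1` for which `z (m + 1)` is a square root of `f m` at `z`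
for all `m < n`. -/
def partialRootTower (f : ℕ → MvPolynomial ℕ ℂ) (n : ℕ) : Set (ℕ → ℂ) :=
  {z | ‖z 0‖ ≤ 1 ∧ ∀ m < n, z (m + 1) ^ 2 = MvPolynomial.eval z (f m)}

/-- The set of all `z` with `‖z 0‖ ≤ 1` for which `z (m + 1)` is a square root of `f m` at `z`
for all `m`. -/
def rootTower (f : ℕ → MvPolynomial ℕ ℂ) : Set (ℕ → ℂ) :=
  {z | ‖z 0‖ ≤ 1 ∧ ∀ m, z (m + 1) ^ 2 = MvPolynomial.eval z (f m)}

lemma norm_linCoeff_le_of_partialRootTower {f : ℕ → MvPolynomial ℕ ℂ}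
    (hf : ∀ n, f n ∈ MvPolynomial.supported ℂ (Set.Iic n))
    (h₀ : ∀ n, MvPolynomial.eval 0 (f n) = 0) (h₁ : ∀ n, linCoeff (f n) = 0) (M : ℝ) (n : ℕ)
    {p : MvPolynomial ℕ ℂ} (hp : p ∈ MvPolynomial.supported ℂ (Set.Iic n))
    (hM : ∀ z ∈ partialRootTower f n, ‖MvPolynomial.eval z p‖ ≤ M) : ‖linCoeff p‖ ≤ M := by
  induction n generalizing p with
  | zero =>
    have hd : Differentiable ℂ (fun w : ℂ => MvPolynomial.eval (Pi.single 0 w) p) :=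
      fun w => (hasDerivAt_eval_single p w).differentiableAt
    have := Complex.norm_deriv_le_of_forall_mem_sphere_norm_le (c := 0) (R := 1) (C := M)
      one_pos hd.diffContOnCl fun w hw => hM _ ⟨by simpa using (mem_sphere_zero_iff_norm.mp hw).le,
        by simp⟩
    rw [(hasDerivAt_eval_single p 0).deriv] at this
    simpa [linCoeff_apply] using this
  | succ n ih =>
    obtain ⟨q, hq, hl, he⟩ := exists_average_sqrt (hf n) (h₀ n) (h₁ n) hp
    rw [← hl]
    refine ih hq fun z hz => ?_
    obtain ⟨y, hy⟩ := IsAlgClosed.exists_pow_nat_eq (MvPolynomial.eval z (f n)) two_pos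
    have hmem : ∀ y : ℂ, y ^ 2 = MvPolynomial.eval z (f n) →
        Function.update z (n + 1) y ∈ partialRootTower f (n + 1) := by
      intro y hy
      refine ⟨by simpa [Function.update_apply] using hz.1, fun m hm => ?_⟩
      have hev : MvPolynomial.eval (Function.update z (n + 1) y) (f m) =
          MvPolynomial.eval z (f m) := by
        refine eval_congr_of_mem_supported (hf m) fun i hi => ?_
        rw [Function.update_of_ne]
        have : i ≤ m := hi
        omega
      rw [hev]
      rcases eq_or_ne m n with rfl | hne
      · rw [Function.update_self, hy]
      · rw [Function.update_of_ne (by omega), hz.2 m (by omega)]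
    have h2 : ‖2 * MvPolynomial.eval z q‖ ≤ M + M := by
      rw [he z y hy]
      exact (norm_add_le _ _).trans
        (add_le_add (hM _ (hmem y hy)) (hM _ (hmem (-y) (by rw [neg_sq, hy]))))
    rw [norm_mul, Complex.norm_ofNat] at h2
    linarith

lemma exists_mem_rootTower {f : ℕ → MvPolynomial ℕ ℂ}
    (hf : ∀ n, f n ∈ MvPolynomial.supported ℂ (Set.Iic n)) {n : ℕ} {z : ℕ → ℂ}
    (hz : z ∈ partialRootTower f n) : ∃ z' ∈ rootTower f, ∀ i ≤ n, z' i = z i := by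
  choose r hr using fun c : ℂ => IsAlgClosed.exists_pow_nat_eq c two_pos
  let u : ℕ → ℕ → ℂ := fun k => Nat.rec z (fun k v =>
    if k < n then v else Function.update v (k + 1) (r (MvPolynomial.eval v (f k)))) k
  have hu : ∀ k, u (k + 1) = if k < n then u k else
    Function.update (u k) (k + 1) (r (MvPolynomial.eval (u k) (f k))) := fun k => rfl
  have hstep : ∀ k i, i ≤ k → u (k + 1) i = u k i := by
    intro k i hik
    rw [hu]
    split_ifs
    · rfl
    · rw [Function.update_of_ne (by omega)]
  have hdiag : ∀ i d, u (i + d) i = u i i := by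
    intro i d
    induction d with
    | zero => rfl
    | succ d ih => rw [← add_assoc, hstep _ _ (by omega), ih]
  have hlow : ∀ k ≤ n, u k = z := by
    intro k hk
    induction k with
    | zero => rfl
    | succ k ih => rw [hu, if_pos (by omega), ih (by omega)]
  have heval : ∀ m, MvPolynomial.eval (fun i => u i i) (f m) = MvPolynomial.eval (u m) (f m) := by
    refine fun m => eval_congr_of_mem_supported (hf m) fun i hi => ?_
    obtain ⟨d, rfl⟩ := Nat.exists_eq_add_of_le (show i ≤ m from hi)
    exact (hdiag i d).symm
  refine ⟨fun i => u i i, ⟨hz.1, fun m => ?_⟩, fun i hi => by simp only [hlow i hi]⟩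
  rw [heval]
  by_cases hm : m < n
  · rw [hlow m hm.le, ← hz.2 m hm]
    exact congrArg (fun v : ℕ → ℂ => v (m + 1) ^ 2) (hlow (m + 1) hm)
  · simp only [hu m, if_neg hm, Function.update_self, hr]

lemma norm_linCoeff_le {f : ℕ → MvPolynomial ℕ ℂ}
    (hf : ∀ n, f n ∈ MvPolynomial.supported ℂ (Set.Iic n))
    (h₀ : ∀ n, MvPolynomial.eval 0 (f n) = 0) (h₁ : ∀ n, linCoeff (f n) = 0)
    (p : MvPolynomial ℕ ℂ) (M : ℝ)
    (hM : ∀ z ∈ rootTower f, ‖MvPolynomial.eval z p‖ ≤ M) : ‖linCoeff p‖ ≤ M := by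
  have hp : p ∈ MvPolynomial.supported ℂ (Set.Iic (p.vars.sup id)) :=
    MvPolynomial.mem_supported.mpr fun i hi => Finset.le_sup (f := id) hi
  refine norm_linCoeff_le_of_partialRootTower hf h₀ h₁ M _ hp fun z hz => ?_
  obtain ⟨z', hz', h⟩ := exists_mem_rootTower hf hz
  rw [← eval_congr_of_mem_supported hp h]
  exact hM z' hz'

lemma exists_bound_eval_of_mem_supported {S : Set (ℕ → ℂ)} {s : Set ℕ}
    (hs : ∀ i ∈ s, ∃ R : ℝ, ∀ z ∈ S, ‖z i‖ ≤ R) {p : MvPolynomial ℕ ℂ}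
    (hp : p ∈ MvPolynomial.supported ℂ s) :
    ∃ R : ℝ, ∀ z ∈ S, ‖MvPolynomial.eval z p‖ ≤ R := by
  rw [MvPolynomial.supported_eq_adjoin_X] at hp
  induction hp using Algebra.adjoin_induction with
  | mem x hx =>
    obtain ⟨i, hi, rfl⟩ := hx
    simpa using hs i hi
  | algebraMap r => exact ⟨‖r‖, fun z _ => by simp [MvPolynomial.algebraMap_eq]⟩
  | add x y _ _ hx hy =>
    obtain ⟨R, hR⟩ := hx
    obtain ⟨T, hT⟩ := hy
    refine ⟨R + T, fun z hz => ?_⟩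
    rw [map_add]
    exact (norm_add_le _ _).trans (add_le_add (hR z hz) (hT z hz))
  | mul x y _ _ hx hy =>
    obtain ⟨R, hR⟩ := hx
    obtain ⟨T, hT⟩ := hy
    refine ⟨R * T, fun z hz => ?_⟩
    rw [map_mul, norm_mul]
    exact mul_le_mul (hR z hz) (hT z hz) (norm_nonneg _) ((norm_nonneg _).trans (hR z hz))

lemma exists_bound_coord_rootTower {f : ℕ → MvPolynomial ℕ ℂ}
    (hf : ∀ n, f n ∈ MvPolynomial.supported ℂ (Set.Iic n)) (i : ℕ) :
    ∃ R : ℝ, ∀ z ∈ rootTower f, ‖z i‖ ≤ R := by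
  induction i using Nat.strong_induction_on with
  | _ i ih =>
    rcases i with _ | n
    · exact ⟨1, fun z hz => hz.1⟩
    · obtain ⟨R, hR⟩ := exists_bound_eval_of_mem_supported
        (fun i (hi : i ∈ Set.Iic n) => ih i (Nat.lt_succ_of_le hi)) (hf n)
      refine ⟨R + 1, fun z hz => ?_⟩
      have h1 := hR z hz
      rw [← hz.2 n, norm_pow] at h1
      nlinarith [sq_nonneg (‖z (n + 1)‖ - 1)]

lemma isClosed_rootTower (f : ℕ → MvPolynomial ℕ ℂ) : IsClosed (rootTower f) := by
  have hcl : rootTower f = {z : ℕ → ℂ | ‖z 0‖ ≤ 1} ∩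
      ⋂ m, {z : ℕ → ℂ | z (m + 1) ^ 2 = MvPolynomial.eval z (f m)} := by
    ext z
    simp [rootTower]
  rw [hcl]
  exact (isClosed_le (continuous_apply 0).norm continuous_const).inter <| isClosed_iInter fun m =>
    isClosed_eq ((continuous_apply (m + 1)).pow 2) (MvPolynomial.continuous_eval (f m))

lemma isCompact_rootTower {f : ℕ → MvPolynomial ℕ ℂ}
    (hf : ∀ n, f n ∈ MvPolynomial.supported ℂ (Set.Iic n)) : IsCompact (rootTower f) := by
  choose R hR using exists_bound_coord_rootTower hf
  have hK : IsCompact (Set.univ.pi fun i => Metric.closedBall (0 : ℂ) (R i)) :=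
    isCompact_univ_pi fun i => isCompact_closedBall (0 : ℂ) (R i)
  refine hK.of_isClosed_subset (isClosed_rootTower f) fun z hz i _ => ?_
  rw [mem_closedBall_zero_iff]
  exact hR i z hz

lemma norm_mobius_sub_le {a t : ℝ} {c : ℂ} {δ : ℝ} (hδ₀ : 0 < δ) (hδ₁ : δ ≤ 1) (ha : a = 1 - δ)
    (ht₁ : t ≤ 1) (ht : 1 - δ ^ 2 ≤ t) (hc : ‖c‖ ≤ 1 / 2) {u v : ℂ}
    (hu : u * (1 - a * c) = c - a) (hv : v * (1 - a * t) = t - a) : 2 - 6 * δ ≤ ‖u - v‖ := by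
  have ha₀ : 0 ≤ a := by linarith
  have hat : a * t ≤ a := mul_le_of_le_one_right ha₀ ht₁
  have hat' : δ ≤ 1 - a * t := by linarith
  have h1 : ‖1 - v‖ ≤ 2 * δ := by
    have h : (1 - v) * ((1 - a * t : ℝ) : ℂ) = (((1 + a) * (1 - t) : ℝ) : ℂ) := by
      push_cast
      linear_combination -hv
    have hn := congrArg norm h
    rw [norm_mul, Complex.norm_real, Complex.norm_real, Real.norm_of_nonneg (by linarith),
      Real.norm_of_nonneg (mul_nonneg (by linarith) (by linarith))] at hn
    have h2 : ‖1 - v‖ * δ ≤ 2 * δ * δ := by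
      calc ‖1 - v‖ * δ ≤ ‖1 - v‖ * (1 - a * t) := by gcongr
        _ = (1 + a) * (1 - t) := hn
        _ ≤ 2 * δ ^ 2 := by
          apply mul_le_mul <;> linarith
        _ = 2 * δ * δ := by ring
    exact le_of_mul_le_mul_right h2 hδ₀
  have h2 : ‖u + 1‖ ≤ 4 * δ := by
    have h : (u + 1) * (1 - a * c) = ((1 - a : ℝ) : ℂ) * (1 + c) := by
      push_cast
      linear_combination hu
    have hn := congrArg norm h
    rw [norm_mul, norm_mul, Complex.norm_real, Real.norm_of_nonneg (by linarith)] at hn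
    have hac : ‖(a : ℂ) * c‖ ≤ 1 / 2 := by
      rw [norm_mul, Complex.norm_real, Real.norm_of_nonneg ha₀]
      nlinarith [norm_nonneg c]
    have hlow : 1 / 2 ≤ ‖1 - a * c‖ := by
      have := norm_sub_norm_le (1 : ℂ) (a * c)
      rw [norm_one] at this
      linarith
    have hup : ‖1 + c‖ ≤ 2 := by
      have := norm_add_le (1 : ℂ) c
      rw [norm_one] at this
      linarith
    have h3 : ‖u + 1‖ * (1 / 2) ≤ δ * 2 := by
      calc ‖u + 1‖ * (1 / 2) ≤ ‖u + 1‖ * ‖1 - a * c‖ := by gcongr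
        _ = (1 - a) * ‖1 + c‖ := hn
        _ ≤ δ * 2 := by
          rw [ha, sub_sub_cancel]
          gcongr
    linarith
  have h3 : (2 : ℂ) = (u + 1) + (1 - v) - (u - v) := by ring
  have h4 : (2 : ℝ) ≤ ‖u + 1‖ + ‖1 - v‖ + ‖u - v‖ := by
    calc (2 : ℝ) = ‖(2 : ℂ)‖ := by simp
      _ = ‖(u + 1) + (1 - v) - (u - v)‖ := by rw [← h3]
      _ ≤ ‖(u + 1) + (1 - v)‖ + ‖u - v‖ := norm_sub_le _ _
      _ ≤ _ := by gcongr; exact norm_add_le _ _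
  linarith

lemma Complex.norm_sub_real_le_norm_one_sub_mul {a : ℝ} (ha₀ : 0 ≤ a) (ha₁ : a ≤ 1) {w : ℂ}
    (hw : ‖w‖ ≤ 1) : ‖w - a‖ ≤ ‖1 - a * w‖ := by
  rw [← sq_le_sq₀ (norm_nonneg _) (norm_nonneg _), ← Complex.normSq_eq_norm_sq,
    ← Complex.normSq_eq_norm_sq]
  have h : Complex.normSq w ≤ 1 := by
    rw [Complex.normSq_eq_norm_sq]
    nlinarith [norm_nonneg w]
  rw [Complex.normSq_apply] at h ⊢
  rw [Complex.normSq_apply]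
  simp only [Complex.sub_re, Complex.sub_im, Complex.ofReal_re, Complex.ofReal_im, Complex.one_re,
    Complex.one_im, Complex.re_ofReal_mul, Complex.im_ofReal_mul]
  nlinarith [mul_nonneg (sub_nonneg.mpr h) (show 0 ≤ 1 - a ^ 2 by nlinarith)]

lemma norm_character_apply_le [Nonempty X] {A : Subalgebra ℂ C(X, ℂ)}
    (hA : IsClosed (A : Set C(X, ℂ))) (χ : characterSpace ℂ A) (g : A) : ‖χ g‖ ≤ ‖g‖ := by
  have : CompleteSpace A := hA.completeSpace_coe
  have : NormOneClass A := ⟨by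
    change ‖((1 : A) : C(X, ℂ))‖ = 1
    rw [OneMemClass.coe_one, norm_one]⟩
  exact AlgHom.norm_apply_le_self χ g

lemma norm_charDual_sub_eq_two [Nonempty X] {A : Subalgebra ℂ C(X, ℂ)}
    (hA : IsClosed (A : Set C(X, ℂ))) (χ ψ : characterSpace ℂ A)
    (h : ∀ ε > 0, ∃ g : A, ‖g‖ ≤ 1 ∧ ‖χ g‖ ≤ 1 / 2 ∧ 1 - ε ≤ ‖ψ g‖) :
    ‖charDual χ - charDual ψ‖ = 2 := by
  have : CompleteSpace A := hA.completeSpace_coe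
  apply le_antisymm
  · refine ContinuousLinearMap.opNorm_le_bound _ (by norm_num) fun g => ?_
    calc ‖χ g - ψ g‖ ≤ ‖χ g‖ + ‖ψ g‖ := norm_sub_le _ _
      _ ≤ ‖g‖ + ‖g‖ :=
        add_le_add (norm_character_apply_le hA χ g) (norm_character_apply_le hA ψ g)
      _ = 2 * ‖g‖ := by ring
  · refine le_of_forall_pos_le_add fun ε hε => ?_
    set δ : ℝ := min (1 / 2) (ε / 6) with hδ
    have hδ₀ : 0 < δ := by positivity
    have hδ₁ : δ ≤ 1 / 2 := min_le_left _ _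
    have hδε : δ ≤ ε / 6 := min_le_right _ _
    obtain ⟨g, hg₁, hgχ, hgψ⟩ := h (δ ^ 2) (by positivity)
    obtain ⟨θ, hθ, hθψ⟩ : ∃ θ : ℂ, ‖θ‖ = 1 ∧ θ * ψ g = ‖ψ g‖ := by
      have hne : (‖ψ g‖ : ℂ) ≠ 0 := by
        have : 0 < ‖ψ g‖ := by nlinarith
        exact_mod_cast this.ne'
      refine ⟨(starRingEnd ℂ) (ψ g) / ‖ψ g‖, ?_, ?_⟩
      · rw [norm_div, RCLike.norm_conj, Complex.norm_real, norm_norm, div_self]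
        exact_mod_cast hne
      · rw [div_mul_eq_mul_div, Complex.conj_mul', div_eq_iff hne]
        ring
    set a : ℝ := 1 - δ with ha
    have ha₀ : 0 ≤ a := by linarith
    set k : A := θ • g with hk
    have hk₁ : ‖k‖ ≤ 1 := by rw [hk, norm_smul, hθ, one_mul]; exact hg₁
    have hunit : IsUnit (1 - (a : ℂ) • k) := by
      apply isUnit_one_sub_of_norm_lt_one
      rw [norm_smul, Complex.norm_real, Real.norm_of_nonneg ha₀]
      nlinarith [norm_nonneg k]
    obtain ⟨u, hu⟩ := hunit.exists_right_inv
    set m : A := (k - algebraMap ℂ A a) * u with hm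
    have hm_eq : m * (1 - (a : ℂ) • k) = k - algebraMap ℂ A a := by
      rw [hm, mul_assoc, mul_comm u, hu, mul_one]
    have hm₁ : ‖m‖ ≤ 1 := by
      change ‖(m : C(X, ℂ))‖ ≤ 1
      rw [ContinuousMap.norm_le _ zero_le_one]
      intro x
      have hx := DFunLike.congr_fun (congrArg Subtype.val hm_eq) x
      have hkx : ‖(k : C(X, ℂ)) x‖ ≤ 1 := (ContinuousMap.norm_coe_le_norm _ x).trans hk₁
      have hux := DFunLike.congr_fun (congrArg Subtype.val hu) x
      simp only [MulMemClass.coe_mul, ContinuousMap.mul_apply, AddSubgroupClass.coe_sub,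
        ContinuousMap.sub_apply, OneMemClass.coe_one, ContinuousMap.one_apply, SetLike.val_smul,
        ContinuousMap.smul_apply, smul_eq_mul, Subalgebra.coe_algebraMap,
        algebraMap_apply, mul_one] at hx hux
      have hpos : 0 < ‖1 - (a : ℂ) * (k : C(X, ℂ)) x‖ :=
        norm_pos_iff.mpr (left_ne_zero_of_mul_eq_one hux)
      have hle := Complex.norm_sub_real_le_norm_one_sub_mul ha₀ (by linarith) hkx
      rw [← hx, norm_mul] at hle
      exact le_of_mul_le_mul_right (by rwa [one_mul]) hpos
    have hχ : ∀ φ : characterSpace ℂ A, φ m * (1 - a * φ k) = φ k - a := by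
      intro φ
      have := congrArg φ hm_eq
      simpa only [map_mul, map_sub, map_one, map_smul, smul_eq_mul, AlgHomClass.commutes,
        Algebra.algebraMap_self, RingHom.id_apply] using this
    have hψk : ψ k = (‖ψ g‖ : ℂ) := by rw [hk, map_smul, smul_eq_mul, hθψ]
    have hχk : ‖χ k‖ ≤ 1 / 2 := by rwa [hk, map_smul, smul_eq_mul, norm_mul, hθ, one_mul]
    have key := norm_mobius_sub_le hδ₀ (by linarith) ha
      ((norm_character_apply_le hA ψ g).trans hg₁) hgψ hχk (hχ χ) (hψk ▸ hχ ψ)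
    have hop : ‖χ m - ψ m‖ ≤ ‖charDual χ - charDual ψ‖ := by
      have := (charDual χ - charDual ψ).le_opNorm m
      exact this.trans (mul_le_of_le_one_right (norm_nonneg _) hm₁)
    linarith

lemma exists_norm_le_half_of_roots [Nonempty X] {A : Subalgebra ℂ C(X, ℂ)}
    (hA : IsClosed (A : Set C(X, ℂ))) {χ ψ : characterSpace ℂ A} {x : A} (hne : χ x ≠ ψ x)
    (hψ : ψ x ≠ 0)
    (hroot : ∀ (c : ℂ), ∀ η > 0, ∃ a : ℂ, ‖a - c‖ < η ∧
      ∀ k : ℕ, ∃ r : A, r ^ 2 ^ (k + 1) = (x - algebraMap ℂ A a) * x ^ 2)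
    (ε : ℝ) (hε : 0 < ε) : ∃ g : A, ‖g‖ ≤ 1 ∧ ‖χ g‖ ≤ 1 / 2 ∧ 1 - ε ≤ ‖ψ g‖ := by
  set t : ℝ := max (1 - ε) 0 with ht
  have ht₀ : 0 ≤ t := le_max_right _ _
  have ht₁ : t < 1 := max_lt (by linarith) one_pos
  set D : ℝ := ‖χ x - ψ x‖ with hD
  have hD₀ : 0 < D := norm_pos_iff.mpr (sub_ne_zero.mpr hne)
  have hψ₀ : 0 < ‖ψ x‖ := norm_pos_iff.mpr hψ
  set R : ℝ := ‖x‖ with hR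
  have hR₀ : 0 ≤ R := norm_nonneg x
  have hχR : ‖χ x‖ ≤ R := norm_character_apply_le hA χ x
  set M : ℝ := (2 * R + 1) * R ^ 2 + 1 with hM
  have hM₀ : 0 < M := by positivity
  obtain ⟨k, hk⟩ := exists_pow_lt_of_lt_one
    (show 0 < M⁻¹ * (D / 2 * ‖ψ x‖ ^ 2) by positivity) ht₁
  set N : ℕ := 2 ^ (k + 1) with hN
  have hN₀ : N ≠ 0 := by positivity
  have hkN : k ≤ N := (Nat.lt_two_pow_self.le).trans (Nat.pow_le_pow_right two_pos k.le_succ)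
  set η : ℝ := min (D / 2) (min 1 ((1 / 2) ^ N * M / (R ^ 2 + 1))) with hη
  have hη₀ : 0 < η := by positivity
  have hηD : η ≤ D / 2 := min_le_left _ _
  have hη₁ : η ≤ 1 := (min_le_right _ _).trans (min_le_left _ _)
  have hηN : η ≤ (1 / 2) ^ N * M / (R ^ 2 + 1) := (min_le_right _ _).trans (min_le_right _ _)
  obtain ⟨a, ha, hr⟩ := hroot (χ x) η hη₀
  obtain ⟨r, hr⟩ := hr k
  rw [← hN] at hr
  obtain ⟨s, hs₀, hs⟩ : ∃ s : ℝ, 0 ≤ s ∧ s ^ N = M⁻¹ :=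
    ⟨M⁻¹ ^ ((N : ℝ)⁻¹), by positivity, Real.rpow_inv_natCast_pow (by positivity) hN₀⟩
  have hφ : ∀ φ : characterSpace ℂ A,
      ‖φ ((s : ℂ) • r)‖ ^ N = M⁻¹ * (‖φ x - a‖ * ‖φ x‖ ^ 2) := by
    intro φ
    have h := congrArg (fun y => ‖φ y‖) hr
    simp only [map_mul, map_pow, map_sub, AlgHomClass.commutes, Algebra.algebraMap_self,
      RingHom.id_apply, norm_mul, norm_pow] at h
    rw [map_smul, norm_smul, mul_pow, h, Complex.norm_real, Real.norm_of_nonneg hs₀, hs]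
  have ha' : ‖a‖ ≤ R + 1 := by
    have := norm_sub_norm_le a (χ x)
    linarith
  refine ⟨(s : ℂ) • r, ?_, ?_, ?_⟩
  · change ‖(((s : ℂ) • r : A) : C(X, ℂ))‖ ≤ 1
    rw [ContinuousMap.norm_le _ zero_le_one]
    intro y
    have h := hφ (evalChar A y)
    change ‖(((s : ℂ) • r : A) : C(X, ℂ)) y‖ ^ N =
      M⁻¹ * (‖(x : C(X, ℂ)) y - a‖ * ‖(x : C(X, ℂ)) y‖ ^ 2) at h
    have hxy : ‖(x : C(X, ℂ)) y‖ ≤ R := ContinuousMap.norm_coe_le_norm _ y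
    have hxa : ‖(x : C(X, ℂ)) y - a‖ ≤ 2 * R + 1 := (norm_sub_le _ _).trans (by linarith)
    rw [← pow_le_one_iff_of_nonneg (norm_nonneg _) hN₀, h, inv_mul_le_one₀ hM₀]
    calc _ ≤ (2 * R + 1) * R ^ 2 := by gcongr
      _ ≤ M := by rw [hM]; linarith
  · rw [← pow_le_pow_iff_left₀ (norm_nonneg _) (by norm_num) hN₀, hφ χ, inv_mul_le_iff₀ hM₀]
    calc ‖χ x - a‖ * ‖χ x‖ ^ 2 ≤ η * R ^ 2 := by
          rw [norm_sub_rev]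
          gcongr
      _ ≤ η * (R ^ 2 + 1) := by gcongr; linarith
      _ ≤ (1 / 2) ^ N * M := by rwa [le_div_iff₀ (by positivity)] at hηN
      _ = _ := mul_comm _ _
  · refine (le_max_left (1 - ε) 0).trans (lt_of_pow_lt_pow_left₀ N (norm_nonneg _) ?_).le
    rw [hφ ψ]
    refine (pow_le_pow_of_le_one ht₀ ht₁.le hkN).trans_lt (hk.trans_le ?_)
    have : D / 2 ≤ ‖ψ x - a‖ := by
      have h1 : χ x - ψ x = -(a - χ x) - (ψ x - a) := by ring
      have h2 : D ≤ ‖a - χ x‖ + ‖ψ x - a‖ := by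
        rw [hD, h1]
        exact (norm_sub_le _ _).trans (by rw [norm_neg])
      linarith
    gcongr

lemma exists_root_sequence : ∃ f : ℕ → MvPolynomial ℕ ℂ,
    (∀ n, f n ∈ MvPolynomial.supported ℂ (Set.Iic n)) ∧
    (∀ n, MvPolynomial.eval 0 (f n) = 0) ∧ (∀ n, linCoeff (f n) = 0) ∧
    (∀ (i : ℕ) (c : ℂ), ∀ η > 0, ∃ a : ℂ, ‖a - c‖ < η ∧
      ∃ n, f n = (MvPolynomial.X i - MvPolynomial.C a) * MvPolynomial.X i ^ 2) ∧
    ∀ m, ∃ n, f n = MvPolynomial.X (m + 1) := by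
  classical
  let e : (ℕ × ℕ) ⊕ ℕ → MvPolynomial ℕ ℂ := Sum.elim
    (fun ik => (MvPolynomial.X ik.1 - MvPolynomial.C (TopologicalSpace.denseSeq ℂ ik.2)) *
      MvPolynomial.X ik.1 ^ 2) (fun m => MvPolynomial.X (m + 1))
  obtain ⟨s, hs⟩ := exists_surjective_nat ((ℕ × ℕ) ⊕ ℕ)
  let f : ℕ → MvPolynomial ℕ ℂ := fun n =>
    if e (s n.unpair.1) ∈ MvPolynomial.supported ℂ (Set.Iic n) then e (s n.unpair.1) else 0
  have he₀ : ∀ τ, MvPolynomial.eval 0 (e τ) = 0 := by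
    rintro (τ | m) <;> simp [e]
  have he₁ : ∀ τ, linCoeff (e τ) = 0 := by
    rintro (τ | m)
    · simp [e, linCoeff_mul, pow_two]
    · exact linCoeff_X_succ m
  have hfe : ∀ τ, ∃ n, f n = e τ := by
    intro τ
    obtain ⟨l, rfl⟩ := hs τ
    let b := (e (s l)).vars.sup id
    refine ⟨Nat.pair l b, ?_⟩
    simp only [f, Nat.unpair_pair]
    rw [if_pos]
    rw [MvPolynomial.mem_supported]
    intro i hi
    exact (Finset.le_sup (f := id) hi).trans (Nat.right_le_pair l b)
  refine ⟨f, fun n => ?_, fun n => ?_, fun n => ?_, fun i c η hη => ?_, fun m => hfe (.inr m)⟩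
  · by_cases h : e (s n.unpair.1) ∈ MvPolynomial.supported ℂ (Set.Iic n)
    · simpa only [f, if_pos h] using h
    · simpa only [f, if_neg h] using zero_mem _
  · simp only [f]
    split_ifs
    · exact he₀ _
    · exact map_zero _
  · simp only [f]
    split_ifs
    · exact he₁ _
    · exact map_zero _
  · obtain ⟨k, hk⟩ := (TopologicalSpace.denseRange_denseSeq ℂ).exists_dist_lt c hη
    refine ⟨TopologicalSpace.denseSeq ℂ k, ?_, hfe (.inl (i, k))⟩
    rwa [← dist_eq_norm, dist_comm]

/-- Restriction of polynomials to a set `S`, as continuous functions. -/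
def polyRestrict (S : Set (ℕ → ℂ)) : MvPolynomial ℕ ℂ →ₐ[ℂ] C(S, ℂ) :=
  MvPolynomial.aeval fun i => ⟨fun z => z.1 i, (continuous_apply i).comp continuous_subtype_val⟩

lemma polyRestrict_apply (S : Set (ℕ → ℂ)) (p : MvPolynomial ℕ ℂ) (z : S) :
    polyRestrict S p z = MvPolynomial.eval z.1 p := by
  induction p using MvPolynomial.induction_on with
  | C a => simp [polyRestrict]
  | add p q hp hq => simp [hp, hq]
  | mul_X p i hp =>
    simp only [map_mul, ContinuousMap.mul_apply, hp, MvPolynomial.eval_X]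
    simp [polyRestrict]

/-- The uniform closure on `S` of the polynomials. -/
def polyAlgebra (S : Set (ℕ → ℂ)) [CompactSpace S] : Subalgebra ℂ C(S, ℂ) :=
  (polyRestrict S).range.topologicalClosure

/-- Restriction of polynomials to `S`, as elements of `polyAlgebra S`. -/
def toPolyAlgebra (S : Set (ℕ → ℂ)) [CompactSpace S] : MvPolynomial ℕ ℂ →ₐ[ℂ] polyAlgebra S :=
  (polyRestrict S).codRestrict _ fun p => Subalgebra.le_topologicalClosure _ ⟨p, rfl⟩

lemma coe_toPolyAlgebra (S : Set (ℕ → ℂ)) [CompactSpace S] (p : MvPolynomial ℕ ℂ) (z : S) :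
    (toPolyAlgebra S p : C(S, ℂ)) z = MvPolynomial.eval z.1 p :=
  polyRestrict_apply S p z

lemma denseRange_toPolyAlgebra (S : Set (ℕ → ℂ)) [CompactSpace S] :
    DenseRange (toPolyAlgebra S) := by
  intro g
  rw [Topology.IsInducing.subtypeVal.closure_eq_preimage_closure_image, ← Set.range_comp]
  exact g.2

lemma isUniformAlgebra_polyAlgebra (S : Set (ℕ → ℂ)) [CompactSpace S] :
    IsUniformAlgebra (polyAlgebra S) := by
  refine ⟨Subalgebra.isClosed_topologicalClosure _, fun x y hxy => ?_⟩
  obtain ⟨i, hi⟩ := Function.ne_iff.mp (Subtype.coe_ne_coe.mpr hxy)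
  refine ⟨_, (toPolyAlgebra S (MvPolynomial.X i)).2, ?_⟩
  simpa only [coe_toPolyAlgebra, MvPolynomial.eval_X] using hi

lemma exists_character_X_ne {S : Set (ℕ → ℂ)} [CompactSpace S]
    {χ ψ : characterSpace ℂ (polyAlgebra S)} (h : χ ≠ ψ) :
    ∃ i, χ (toPolyAlgebra S (MvPolynomial.X i)) ≠ ψ (toPolyAlgebra S (MvPolynomial.X i)) := by
  contrapose! h
  have hp : ∀ p, χ (toPolyAlgebra S p) = ψ (toPolyAlgebra S p) := by
    intro p
    induction p using MvPolynomial.induction_on with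
    | C a => rw [← MvPolynomial.algebraMap_eq]; simp only [AlgHomClass.commutes]
    | add p q hp hq => simp only [map_add, hp, hq]
    | mul_X p i hp => simp only [map_mul, hp, h]
  refine DFunLike.coe_injective ?_
  exact (denseRange_toPolyAlgebra S).equalizer (map_continuous χ) (map_continuous ψ) (funext hp)

lemma exists_root_toPolyAlgebra {f : ℕ → MvPolynomial ℕ ℂ} [CompactSpace (rootTower f)]
    (hX : ∀ m, ∃ n, f n = MvPolynomial.X (m + 1)) (k n : ℕ) :
    ∃ m, toPolyAlgebra (rootTower f) (MvPolynomial.X (m + 1)) ^ 2 ^ (k + 1) =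
      toPolyAlgebra (rootTower f) (f n) := by
  have hsq : ∀ n, toPolyAlgebra (rootTower f) (MvPolynomial.X (n + 1)) ^ 2 =
      toPolyAlgebra (rootTower f) (f n) := by
    intro n
    ext z
    rw [← map_pow, coe_toPolyAlgebra, coe_toPolyAlgebra, map_pow, MvPolynomial.eval_X]
    exact z.2.2 n
  induction k with
  | zero => exact ⟨n, by simpa using hsq n⟩
  | succ k ih =>
    obtain ⟨m, hm⟩ := ih
    obtain ⟨l, hl⟩ := hX m
    refine ⟨l, ?_⟩
    rw [pow_succ' 2 (k + 1), pow_mul, hsq, hl, hm]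

lemma norm_charDual_sub_rootTower {f : ℕ → MvPolynomial ℕ ℂ} [CompactSpace (rootTower f)]
    [Nonempty (rootTower f)]
    (hq : ∀ (i : ℕ) (c : ℂ), ∀ η > 0, ∃ a : ℂ, ‖a - c‖ < η ∧
      ∃ n, f n = (MvPolynomial.X i - MvPolynomial.C a) * MvPolynomial.X i ^ 2)
    (hX : ∀ m, ∃ n, f n = MvPolynomial.X (m + 1))
    {χ ψ : characterSpace ℂ (polyAlgebra (rootTower f))} (h : χ ≠ ψ) :
    ‖charDual χ - charDual ψ‖ = 2 := by
  have hcl := (isUniformAlgebra_polyAlgebra (rootTower f)).1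
  obtain ⟨i, hi⟩ := exists_character_X_ne h
  have hroot : ∀ (c : ℂ), ∀ η > 0, ∃ a : ℂ, ‖a - c‖ < η ∧
      ∀ k : ℕ, ∃ r : polyAlgebra (rootTower f), r ^ 2 ^ (k + 1) =
        (toPolyAlgebra _ (MvPolynomial.X i) - algebraMap ℂ _ a) *
          toPolyAlgebra _ (MvPolynomial.X i) ^ 2 := by
    intro c η hη
    obtain ⟨a, ha, n, hn⟩ := hq i c η hη
    refine ⟨a, ha, fun k => ?_⟩
    obtain ⟨m, hm⟩ := exists_root_toPolyAlgebra hX k n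
    refine ⟨_, hm.trans ?_⟩
    rw [hn, map_mul, map_sub, map_pow, ← MvPolynomial.algebraMap_eq, AlgHomClass.commutes]
  by_cases hψ : ψ (toPolyAlgebra _ (MvPolynomial.X i)) = 0
  · exact (norm_sub_rev (charDual χ) (charDual ψ)).trans (norm_charDual_sub_eq_two hcl ψ χ
      (exists_norm_le_half_of_roots hcl hi.symm (hψ ▸ hi) hroot))
  · exact norm_charDual_sub_eq_two hcl χ ψ (exists_norm_le_half_of_roots hcl hi hψ hroot)

lemma exists_bounded_point_derivation {S : Set (ℕ → ℂ)} [CompactSpace S] (h₀ : 0 ∈ S)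
    (hS : ∀ (p : MvPolynomial ℕ ℂ) (M : ℝ), (∀ z ∈ S, ‖MvPolynomial.eval z p‖ ≤ M) →
      ‖linCoeff p‖ ≤ M) :
    ∃ (φ : characterSpace ℂ (polyAlgebra S)) (ψ : polyAlgebra S →L[ℂ] ℂ), ψ ≠ 0 ∧
      ∀ f g : polyAlgebra S, ψ (f * g) = ψ f * φ g + φ f * ψ g := by
  have hd := denseRange_toPolyAlgebra S
  have hbound : ∀ p, ‖linCoeff p‖ ≤ 1 * ‖(toPolyAlgebra S).toLinearMap p‖ := by
    refine fun p => hS p _ fun z hz => ?_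
    rw [one_mul, ← coe_toPolyAlgebra S p ⟨z, hz⟩]
    exact ContinuousMap.norm_coe_le_norm (toPolyAlgebra S p : C(S, ℂ)) ⟨z, hz⟩
  let D : polyAlgebra S →L[ℂ] ℂ := linCoeff.extendOfNorm (toPolyAlgebra S).toLinearMap
  have hext : ∀ p, D (toPolyAlgebra S p) = linCoeff p := LinearMap.extendOfNorm_eq hd ⟨1, hbound⟩
  let φ : characterSpace ℂ (polyAlgebra S) := evalChar (polyAlgebra S) ⟨0, h₀⟩
  have heval : ∀ p, φ (toPolyAlgebra S p) = MvPolynomial.eval 0 p :=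
    fun p => coe_toPolyAlgebra S p ⟨0, h₀⟩
  have hD : Continuous D := D.continuous
  have hφ : Continuous φ := map_continuous φ
  refine ⟨φ, D, fun h => ?_, fun f g => ?_⟩
  · have := hext (MvPolynomial.X 0)
    rw [h, linCoeff_X_zero] at this
    exact zero_ne_one this
  · refine hd.induction_on₂ (p := fun f g : polyAlgebra S => D (f * g) = D f * φ g + φ f * D g)
      ?_ (fun p q => ?_) f g
    · exact isClosed_eq (hD.comp (continuous_fst.mul continuous_snd))
        (((hD.comp continuous_fst).mul (hφ.comp continuous_snd)).add
          ((hφ.comp continuous_fst).mul (hD.comp continuous_snd)))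
    · rw [← map_mul, hext, hext, hext, heval, heval, linCoeff_mul]

/-- There is a uniform algebra on a compact metrizable space having a
nonzero bounded point derivation at some character, but all of whose Gleason parts are
one-point parts (i.e. `‖φ - ψ‖ = 2` for all distinct characters `φ, ψ`). -/
theorem exists_uniformAlgebra_bounded_point_derivation_trivial_gleason_parts :
    ∃ (X : Type) (_ : TopologicalSpace X) (_ : CompactSpace X) (_ : T2Space X)
      (_ : TopologicalSpace.MetrizableSpace X) (B : Subalgebra ℂ C(X, ℂ)),
      IsUniformAlgebra B ∧
      (∃ (φ : characterSpace ℂ B) (ψ : B →L[ℂ] ℂ), ψ ≠ 0 ∧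
        ∀ f g : B, ψ (f * g) = ψ f * φ g + φ f * ψ g) ∧
      (∀ φ ψ : characterSpace ℂ B, φ ≠ ψ → ‖charDual φ - charDual ψ‖ = 2) := by
  obtain ⟨f, hf, h₀, h₁, hq, hX⟩ := exists_root_sequence
  have hc : CompactSpace (rootTower f) := isCompact_iff_compactSpace.mp (isCompact_rootTower hf)
  have hmem : (0 : ℕ → ℂ) ∈ rootTower f :=
    ⟨by simp, fun m => (zero_pow two_ne_zero).trans (h₀ m).symm⟩
  have hne : Nonempty (rootTower f) := ⟨⟨0, hmem⟩⟩
  exact ⟨rootTower f, inferInstance, hc, inferInstance, inferInstance, polyAlgebra (rootTower f),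
    isUniformAlgebra_polyAlgebra _,
    exists_bounded_point_derivation hmem (norm_linCoeff_le hf h₀ h₁),
    fun _ _ h => norm_charDual_sub_rootTower hq hX h⟩

end
end

section
/- There exist a compact Hausdorff space X and a uniform algebra B on X such that B has a nontrivial Gleason part, yet for every character φ of B the only (possibly unbounded) point derivation on B at φ is the zero functional. -/
open WeakDual Topology

set_option synthInstance.maxHeartbeats 400000
set_option maxHeartbeats 1000000
set_option linter.unusedSectionVars false

noncomputable section

variable {X : Type*} [TopologicalSpace X]

variable [CompactSpace X]

/-- Expressions built from the disc coordinate by the algebra operations, limits of sequences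
and square roots. -/
inductive RootExpr : Type
  | const (c : ℂ)
  | coord
  | add (t u : RootExpr)
  | mul (t u : RootExpr)
  | lim (t : ℕ → RootExpr)
  | root (t : RootExpr)

/-- A point of the open unit disc together with a choice of sign for every expression. -/
structure SignedDisc : Type where
  /-- The point of the disc. -/
  pt : Metric.ball (0 : ℂ) 1
  /-- The choice of signs. -/
  sign : RootExpr → Bool

namespace SignedDisc

open BoundedContinuousFunction

instance : TopologicalSpace SignedDisc := ⊥

instance : DiscreteTopology SignedDisc := ⟨rfl⟩

/-- Change the sign attached to the expression `t`. -/
def flip (t : RootExpr) (x : SignedDisc) : SignedDisc := by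
  classical exact ⟨x.pt, Function.update x.sign t (!x.sign t)⟩

/-- The first of the two base points, lying over `0`. -/
def basePt : SignedDisc := ⟨⟨0, by simp⟩, fun _ => true⟩

/-- The second of the two base points, lying over `1 / 4`. -/
def basePt' : SignedDisc := ⟨⟨1 / 4, by norm_num⟩, fun _ => true⟩

/-- The disc coordinate as a bounded function. -/
def coordFun : SignedDisc →ᵇ ℂ :=
  ofNormedAddCommGroupDiscrete (fun x => (x.pt : ℂ)) 1
    fun x => (mem_ball_zero_iff.1 x.pt.2).le

/-- The sign attached to `t`, as a complex number. -/
def signAt (t : RootExpr) (x : SignedDisc) : ℂ := if x.sign t then 1 else -1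

theorem signAt_mul_self (t : RootExpr) (x : SignedDisc) : signAt t x * signAt t x = 1 := by
  unfold signAt; split_ifs <;> norm_num

theorem signAt_flip_self (t : RootExpr) (x : SignedDisc) :
    signAt t (flip t x) = -signAt t x := by
  unfold signAt flip
  cases x.sign t <;> simp

theorem signAt_flip_of_ne {t u : RootExpr} (h : t ≠ u) (x : SignedDisc) :
    signAt t (flip u x) = signAt t x := by
  simp [signAt, flip, h]

theorem cpow_half_mul_self (w : ℂ) : w ^ ((2 : ℂ)⁻¹) * w ^ ((2 : ℂ)⁻¹) = w := by
  rw [← pow_two]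
  exact_mod_cast Complex.cpow_nat_inv_pow w two_ne_zero

/-- The square root of `f` whose sign is prescribed by the sign attached to `t`. -/
def signedRoot (t : RootExpr) (f : SignedDisc →ᵇ ℂ) : SignedDisc →ᵇ ℂ :=
  ofNormedAddCommGroupDiscrete (fun x => signAt t x * (f x) ^ ((2 : ℂ)⁻¹)) (√‖f‖) fun x => by
    refine Real.le_sqrt_of_sq_le ?_
    rw [← norm_pow]
    refine le_trans (le_of_eq ?_) (f.norm_coe_le_norm x)
    congr 1
    linear_combination (f x) ^ ((2 : ℂ)⁻¹) * (f x) ^ ((2 : ℂ)⁻¹) * signAt_mul_self t x +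
      cpow_half_mul_self (f x)

theorem signedRoot_apply (t : RootExpr) (f : SignedDisc →ᵇ ℂ) (x : SignedDisc) :
    signedRoot t f x = signAt t x * (f x) ^ ((2 : ℂ)⁻¹) := rfl

theorem signedRoot_mul_self (t : RootExpr) (f : SignedDisc →ᵇ ℂ) :
    signedRoot t f * signedRoot t f = f := by
  ext x
  simp only [BoundedContinuousFunction.mul_apply, signedRoot_apply]
  linear_combination (f x) ^ ((2 : ℂ)⁻¹) * (f x) ^ ((2 : ℂ)⁻¹) * signAt_mul_self t x +
    cpow_half_mul_self (f x)

open Classical in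
/-- The signed square root of `f` if `f` vanishes at both base points, and `0` otherwise. -/
def rootFun (t : RootExpr) (f : SignedDisc →ᵇ ℂ) : SignedDisc →ᵇ ℂ :=
  if f basePt = 0 ∧ f basePt' = 0 then signedRoot t f else 0

open Classical in
/-- The bounded function denoted by an expression. -/
def eval : RootExpr → (SignedDisc →ᵇ ℂ)
  | .const c => algebraMap ℂ _ c
  | .coord => coordFun
  | .add t u => eval t + eval u
  | .mul t u => eval t * eval u
  | .lim t => if h : ∃ l, Filter.Tendsto (fun n => eval (t n)) Filter.atTop (𝓝 l) then
      h.choose else 0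
  | .root t => rootFun t (eval t)

/-- The closed algebra of all functions denoted by expressions. -/
def exprAlgebra : Subalgebra ℂ (SignedDisc →ᵇ ℂ) where
  carrier := Set.range eval
  mul_mem' := by
    rintro _ _ ⟨t, rfl⟩ ⟨u, rfl⟩
    exact ⟨.mul t u, rfl⟩
  add_mem' := by
    rintro _ _ ⟨t, rfl⟩ ⟨u, rfl⟩
    exact ⟨.add t u, rfl⟩
  algebraMap_mem' c := ⟨.const c, rfl⟩

theorem eval_mem_exprAlgebra (t : RootExpr) : eval t ∈ exprAlgebra := ⟨t, rfl⟩

theorem isClosed_exprAlgebra : IsClosed (exprAlgebra : Set (SignedDisc →ᵇ ℂ)) := by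
  refine isClosed_of_closure_subset fun f hf => ?_
  obtain ⟨g, hg, hgf⟩ := mem_closure_iff_seq_limit.1 hf
  choose t ht using hg
  have h : Filter.Tendsto (fun n => eval (t n)) Filter.atTop (𝓝 f) := by simpa only [ht] using hgf
  have hex : ∃ l, Filter.Tendsto (fun n => eval (t n)) Filter.atTop (𝓝 l) := ⟨f, h⟩
  refine ⟨.lim t, ?_⟩
  rw [eval, dif_pos hex]
  exact tendsto_nhds_unique hex.choose_spec h

theorem exists_sqrt_mem_exprAlgebra {f : SignedDisc →ᵇ ℂ} (hf : f ∈ exprAlgebra)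
    (h : f basePt = 0) (h' : f basePt' = 0) : ∃ g ∈ exprAlgebra, g * g = f := by
  obtain ⟨t, rfl⟩ := hf
  refine ⟨_, eval_mem_exprAlgebra (.root t), ?_⟩
  rw [eval, rootFun, if_pos ⟨h, h'⟩, signedRoot_mul_self]

/-- An algebra on which the base points are at distance at most `1` and which is independent of
the signs attached to those expressions whose root it does not contain. -/
structure IsGood (B : Subalgebra ℂ (SignedDisc →ᵇ ℂ)) : Prop where
  norm_sub_le : ∀ f ∈ B, ‖f basePt - f basePt'‖ ≤ ‖f‖
  apply_flip : ∀ t, rootFun t (eval t) ∉ B → ∀ f ∈ B, ∀ x, f (flip t x) = f x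

/-- The algebra of bounded holomorphic functions of the disc coordinate. -/
def holoAlgebra : Subalgebra ℂ (SignedDisc →ᵇ ℂ) where
  carrier := {f | ∃ h : ℂ → ℂ, DifferentiableOn ℂ h (Metric.ball 0 1) ∧ ∀ x, f x = h x.pt}
  mul_mem' := by
    rintro f g ⟨h, hh, hf⟩ ⟨k, hk, hg⟩
    exact ⟨h * k, hh.mul hk, fun x => by simp [hf, hg]⟩
  add_mem' := by
    rintro f g ⟨h, hh, hf⟩ ⟨k, hk, hg⟩
    exact ⟨h + k, hh.add hk, fun x => by simp [hf, hg]⟩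
  algebraMap_mem' c := ⟨fun _ => c, differentiableOn_const c, fun x => by
    simp [BoundedContinuousFunction.algebraMap_apply]⟩

theorem coordFun_mem_holoAlgebra : coordFun ∈ holoAlgebra :=
  ⟨id, differentiableOn_id, fun _ => rfl⟩

theorem isGood_holoAlgebra : IsGood holoAlgebra where
  norm_sub_le := by
    rintro f ⟨h, hh, hf⟩
    have hmem : ∀ z ∈ Metric.ball (0 : ℂ) 1, ‖h z‖ ≤ ‖f‖ := fun z hz => by
      have := f.norm_coe_le_norm ⟨⟨z, hz⟩, fun _ => true⟩
      rwa [hf] at this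
    have hmaps : Set.MapsTo h (Metric.ball 0 1) (Metric.closedBall (h 0) (2 * ‖f‖)) := by
      intro z hz
      rw [mem_closedBall_iff_norm]
      linarith [norm_sub_le (h z) (h 0), hmem z hz, hmem 0 (by simp)]
    have key := Complex.dist_le_div_mul_dist_of_mapsTo_ball hh hmaps
      (z := 1 / 4) (by norm_num)
    rw [hf, hf, ← dist_eq_norm, dist_comm]
    refine key.trans ?_
    norm_num
    linarith [norm_nonneg f]
  apply_flip := by
    rintro t - f ⟨h, -, hf⟩ x
    rw [hf, hf]
    rfl

theorem IsGood.topologicalClosure {B : Subalgebra ℂ (SignedDisc →ᵇ ℂ)} (hB : IsGood B) :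
    IsGood B.topologicalClosure where
  norm_sub_le f hf := by
    refine closure_minimal (s := (B : Set (SignedDisc →ᵇ ℂ))) (fun f hf => hB.norm_sub_le f hf)
      (isClosed_le (f := fun f : SignedDisc →ᵇ ℂ => ‖f basePt - f basePt'‖)
        (g := fun f => ‖f‖) ?_ continuous_norm) hf
    exact ((continuous_eval_const _).sub (continuous_eval_const _)).norm
  apply_flip t ht f hf x := by
    refine closure_minimal (s := (B : Set (SignedDisc →ᵇ ℂ)))
      (fun f hf => hB.apply_flip t (fun h => ht (B.le_topologicalClosure h)) f hf x)
      (isClosed_eq (f := fun f : SignedDisc →ᵇ ℂ => f (flip t x)) (g := fun f => f x)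
        (continuous_eval_const _) (continuous_eval_const _)) hf

/-- The algebra generated by `B` and an element `g` whose square lies in `B`. -/
def adjoinRoot (B : Subalgebra ℂ (SignedDisc →ᵇ ℂ)) (g : SignedDisc →ᵇ ℂ) (hg : g * g ∈ B) :
    Subalgebra ℂ (SignedDisc →ᵇ ℂ) where
  carrier := {f | ∃ a ∈ B, ∃ b ∈ B, f = a + b * g}
  mul_mem' := by
    rintro _ _ ⟨a, ha, b, hb, rfl⟩ ⟨c, hc, d, hd, rfl⟩
    exact ⟨a * c + b * d * (g * g), add_mem (mul_mem ha hc) (mul_mem (mul_mem hb hd) hg),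
      a * d + b * c, add_mem (mul_mem ha hd) (mul_mem hb hc), by ring⟩
  add_mem' := by
    rintro _ _ ⟨a, ha, b, hb, rfl⟩ ⟨c, hc, d, hd, rfl⟩
    exact ⟨a + c, add_mem ha hc, b + d, add_mem hb hd, by ring⟩
  algebraMap_mem' c := ⟨_, B.algebraMap_mem c, 0, zero_mem _, by simp⟩

theorem IsGood.adjoinRoot {B : Subalgebra ℂ (SignedDisc →ᵇ ℂ)} (hB : IsGood B) {t : RootExpr}
    (ht : eval t ∈ B) (h : eval t basePt = 0) (h' : eval t basePt' = 0)
    (hroot : rootFun t (eval t) ∉ B) :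
    IsGood (adjoinRoot B (signedRoot t (eval t)) (by rwa [signedRoot_mul_self])) where
  norm_sub_le := by
    rintro _ ⟨a, ha, b, hb, rfl⟩
    set g := signedRoot t (eval t) with hg
    have hval : ∀ x, eval t x = 0 → g x = 0 := fun x hx => by simp [hg, signedRoot_apply, hx]
    have hflip : ∀ x, g (flip t x) = -g x := fun x => by
      simp [hg, signedRoot_apply, hB.apply_flip t hroot _ ht, signAt_flip_self]
    have hnorm : ‖a‖ ≤ ‖a + b * g‖ := by
      refine (BoundedContinuousFunction.norm_le (norm_nonneg _)).2 fun x => ?_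
      have h1 := (a + b * g).norm_coe_le_norm x
      have h2 := (a + b * g).norm_coe_le_norm (flip t x)
      simp only [BoundedContinuousFunction.add_apply, BoundedContinuousFunction.mul_apply, hflip,
        hB.apply_flip t hroot _ ha, hB.apply_flip t hroot _ hb] at h1 h2
      have h3 := norm_add_le (a x + b x * g x) (a x + b x * -g x)
      rw [show a x + b x * g x + (a x + b x * -g x) = 2 * a x by ring, norm_mul,
        Complex.norm_ofNat] at h3
      linarith
    simpa [hval _ h, hval _ h'] using (hB.norm_sub_le a ha).trans hnorm
  apply_flip := by
    rintro u hu _ ⟨a, ha, b, hb, rfl⟩ x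
    have huB : rootFun u (eval u) ∉ B := fun hmem => hu ⟨_, hmem, 0, zero_mem _, by simp⟩
    have htu : t ≠ u := by
      rintro rfl
      refine hu ⟨0, zero_mem _, 1, one_mem _, ?_⟩
      simp [rootFun, h, h']
    simp [signedRoot_apply, hB.apply_flip u huB _ ha, hB.apply_flip u huB _ hb,
      hB.apply_flip u huB _ ht, signAt_flip_of_ne htu]

theorem exists_isGood_forall_eval_mem :
    ∃ B : Subalgebra ℂ (SignedDisc →ᵇ ℂ), IsGood B ∧ ∀ t, eval t ∈ B := by
  obtain ⟨B, hle, hmax⟩ := zorn_le_nonempty₀ {B | IsGood B} (fun c hc hchain y hy => by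
    have : Nonempty c := ⟨⟨y, hy⟩⟩
    have hmem : ∀ f, f ∈ (⨆ B : c, (B : Subalgebra ℂ (SignedDisc →ᵇ ℂ))) ↔
        ∃ B ∈ c, f ∈ B := fun f => by
      rw [← SetLike.mem_coe, Subalgebra.coe_iSup_of_directed hchain.directedOn.directed_val]
      simp
    refine ⟨⨆ B : c, (B : Subalgebra ℂ (SignedDisc →ᵇ ℂ)), ⟨?_, ?_⟩,
      fun z hz => le_iSup (fun B : c => (B : Subalgebra ℂ (SignedDisc →ᵇ ℂ))) ⟨z, hz⟩⟩
    · intro f hf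
      obtain ⟨B, hB, hfB⟩ := (hmem f).1 hf
      exact (hc hB).norm_sub_le f hfB
    · intro t ht f hf
      obtain ⟨B, hB, hfB⟩ := (hmem f).1 hf
      exact (hc hB).apply_flip t (fun h => ht ((hmem _).2 ⟨B, hB, h⟩)) f hfB)
    holoAlgebra isGood_holoAlgebra
  have hgood : IsGood B := hmax.prop
  have hclosed : IsClosed (B : Set (SignedDisc →ᵇ ℂ)) := by
    have : B = B.topologicalClosure :=
      hmax.eq_of_le hgood.topologicalClosure B.le_topologicalClosure
    rw [this]
    exact B.isClosed_topologicalClosure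
  refine ⟨B, hgood, fun t => ?_⟩
  induction t with
  | const c => exact B.algebraMap_mem c
  | coord => exact hle coordFun_mem_holoAlgebra
  | add t u ht hu => exact B.add_mem ht hu
  | mul t u ht hu => exact B.mul_mem ht hu
  | lim t ht =>
    rw [eval]
    split_ifs with h
    · exact hclosed.mem_of_tendsto h.choose_spec (Filter.Eventually.of_forall ht)
    · exact zero_mem _
  | root t ht =>
    rw [eval]
    by_cases h : eval t basePt = 0 ∧ eval t basePt' = 0
    · by_contra hroot
      have hadj := hgood.adjoinRoot ht h.1 h.2 hroot
      have heq := hmax.eq_of_le hadj fun a ha => ⟨a, ha, 0, zero_mem _, by simp⟩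
      refine hroot ?_
      rw [heq]
      exact ⟨0, zero_mem _, 1, one_mem _, by simp [rootFun, h]⟩
    · rw [rootFun, if_neg h]
      exact zero_mem _

theorem norm_sub_le_of_mem_exprAlgebra {f : SignedDisc →ᵇ ℂ} (hf : f ∈ exprAlgebra) :
    ‖f basePt - f basePt'‖ ≤ ‖f‖ := by
  obtain ⟨B, hB, hmem⟩ := exists_isGood_forall_eval_mem
  obtain ⟨t, rfl⟩ := hf
  exact hB.norm_sub_le _ (hmem t)

/-- Evaluation at a point, as a character of the algebra of expressions. -/
def evalAt (x : SignedDisc) : characterSpace ℂ exprAlgebra :=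
  ⟨{ toFun := fun f => (f : SignedDisc →ᵇ ℂ) x
     map_add' := fun _ _ => rfl
     map_smul' := fun _ _ => rfl
     cont := (continuous_eval_const x).comp continuous_subtype_val },
   ⟨fun h => by
      have h1 : ((1 : exprAlgebra) : SignedDisc →ᵇ ℂ) x = 0 := DFunLike.congr_fun h 1
      simp at h1,
    fun _ _ => rfl⟩⟩

theorem evalAt_apply (x : SignedDisc) (f : exprAlgebra) :
    evalAt x f = (f : SignedDisc →ᵇ ℂ) x := rfl

instance : Nonempty SignedDisc := ⟨basePt⟩

instance : NormOneClass exprAlgebra := ⟨norm_one (α := SignedDisc →ᵇ ℂ)⟩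

instance : CompleteSpace exprAlgebra := isClosed_exprAlgebra.completeSpace_coe

theorem norm_gelfandTransform (f : exprAlgebra) : ‖gelfandTransform ℂ exprAlgebra f‖ = ‖f‖ := by
  refine le_antisymm ?_ ?_
  · refine (ContinuousMap.norm_le _ (norm_nonneg _)).2 fun φ => ?_
    exact AlgHom.norm_apply_le_self φ f
  · refine (BoundedContinuousFunction.norm_le (f := (f : SignedDisc →ᵇ ℂ))
      (norm_nonneg (gelfandTransform ℂ exprAlgebra f))).2 fun x => ?_
    exact (gelfandTransform ℂ exprAlgebra f).norm_coe_le_norm (evalAt x)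

/-- The algebra of expressions, realized as a uniform algebra on its character space. -/
def gelfandAlgebra : Subalgebra ℂ C(characterSpace ℂ exprAlgebra, ℂ) :=
  (gelfandTransform ℂ exprAlgebra).range

theorem isUniformAlgebra_gelfandAlgebra : IsUniformAlgebra gelfandAlgebra := by
  refine ⟨?_, fun φ ψ h => ?_⟩
  · have hiso : Isometry (gelfandTransform ℂ exprAlgebra) :=
      Isometry.of_dist_eq fun f g => by
        rw [dist_eq_norm f g, dist_eq_norm (gelfandTransform ℂ exprAlgebra f), ← map_sub,
          norm_gelfandTransform]
    have hclosed := hiso.isClosedEmbedding.isClosed_range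
    rwa [← AlgHom.coe_range] at hclosed
  · by_contra! hne
    exact h (CharacterSpace.ext fun f => hne _ ⟨f, rfl⟩)

end SignedDisc

theorem norm_charDual_sub_lt_two {Y : Type*} [TopologicalSpace Y] [CompactSpace Y]
    (B : Subalgebra ℂ C(Y, ℂ)) (x y : Y) (h : ∀ f ∈ B, ‖f x - f y‖ ≤ ‖f‖) :
    ‖charDual (evalChar B x) - charDual (evalChar B y)‖ < 2 := by
  refine lt_of_le_of_lt (ContinuousLinearMap.opNorm_le_bound _ zero_le_one fun f => ?_) one_lt_two
  rw [one_mul]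
  exact h f f.2

/-- If every element on which the distinct characters `p` and `q` vanish is a square, then there
are no nonzero point derivations. -/
theorem pointDerivation_eq_zero_of_exists_sqrt {B : Type*} [CommRing B] [Algebra ℂ B]
    {F : Type*} [FunLike F B ℂ] [AlgHomClass F ℂ B ℂ] (p q φ : F) (hpq : ∃ e, p e ≠ q e)
    (hsqrt : ∀ f, p f = 0 → q f = 0 → ∃ g, g * g = f) (D : B →ₗ[ℂ] ℂ)
    (hD : ∀ f g, D (f * g) = D f * φ g + φ f * D g) : D = 0 := by
  have hχ : ∀ (χ : F) (c : ℂ), χ (algebraMap ℂ B c) = c := fun χ c => AlgHomClass.commutes χ c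
  have hD1 : D 1 = 0 := by simpa using hD 1 1
  have hDc : ∀ c : ℂ, D (algebraMap ℂ B c) = 0 := fun c => by
    rw [Algebra.algebraMap_eq_smul_one, map_smul, hD1, smul_zero]
  have hJ : ∀ f, p f = 0 → q f = 0 → φ f = 0 → D f = 0 := by
    intro f hp hq hφ
    obtain ⟨g, rfl⟩ := hsqrt f hp hq
    have hg : φ g = 0 := by simpa using hφ
    simp [hD, hg]
  ext f
  by_cases h : ∃ u, p u = 0 ∧ q u = 0 ∧ φ u ≠ 0
  · obtain ⟨u, hpu, hqu, hu⟩ := h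
    have h0 : D ((f - algebraMap ℂ B (φ f)) * u) = 0 :=
      hJ _ (by simp [hpu]) (by simp [hqu]) (by simp [hχ])
    rw [hD] at h0
    simpa [hDc, hu, hχ] using h0
  · push Not at h
    obtain ⟨e, he⟩ := hpq
    have hsub : p e - q e ≠ 0 := sub_ne_zero.2 he
    set d : B := algebraMap ℂ B (p e - q e)⁻¹ * (e - algebraMap ℂ B (q e)) with hd
    have hpd : p d = 1 := by simp [hd, hsub, hχ]
    have hqd : q d = 0 := by simp [hd, hχ]
    have hφd : φ (d * d - d) = 0 := h _ (by simp [hpd]) (by simp [hqd])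
    have hDd : D d = 0 := by
      have h1 : D (d * d - d) = 0 := hJ _ (by simp [hpd]) (by simp [hqd]) hφd
      rw [map_sub, hD] at h1
      rw [map_sub, map_mul] at hφd
      have h2 : (2 * φ d - 1) * (2 * φ d - 1) = 1 := by linear_combination 4 * hφd
      linear_combination (2 * φ d - 1) * h1 - D d * h2
    set u : B := f - algebraMap ℂ B (q f) - algebraMap ℂ B (p f - q f) * d with hu
    have hpu : p u = 0 := by simp [hu, hpd, hχ]
    have hqu : q u = 0 := by simp [hu, hqd, hχ]
    have h3 : D u = 0 := hJ u hpu hqu (h u hpu hqu)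
    simpa [hu, hD, hDc, hDd, hχ] using h3

/-- There is a uniform algebra on a compact Hausdorff space having a
nontrivial Gleason part, but no nonzero (possibly unbounded) point derivation at any
character. -/
theorem exists_uniformAlgebra_nontrivial_gleason_part_no_point_derivations :
    ∃ (X : Type) (_ : TopologicalSpace X) (_ : CompactSpace X) (_ : T2Space X)
      (B : Subalgebra ℂ C(X, ℂ)),
      IsUniformAlgebra B ∧
      (∃ φ ψ : characterSpace ℂ B, φ ≠ ψ ∧ ‖charDual φ - charDual ψ‖ < 2) ∧
      (∀ (φ : characterSpace ℂ B) (ψ : B →ₗ[ℂ] ℂ),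
        (∀ f g : B, ψ (f * g) = ψ f * φ g + φ f * ψ g) → ψ = 0) := by
  refine ⟨characterSpace ℂ SignedDisc.exprAlgebra, inferInstance, inferInstance, inferInstance,
    SignedDisc.gelfandAlgebra, SignedDisc.isUniformAlgebra_gelfandAlgebra, ?_⟩
  let p := evalChar SignedDisc.gelfandAlgebra (SignedDisc.evalAt SignedDisc.basePt)
  let q := evalChar SignedDisc.gelfandAlgebra (SignedDisc.evalAt SignedDisc.basePt')
  have hpq : p ≠ q := by
    intro h
    have h1 := DFunLike.congr_fun h (⟨_, ⟨⟨SignedDisc.coordFun,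
      SignedDisc.eval_mem_exprAlgebra .coord⟩, rfl⟩⟩ :
      SignedDisc.gelfandAlgebra)
    have h2 : (0 : ℂ) = 1 / 4 := h1
    norm_num at h2
  refine ⟨⟨p, q, hpq, ?_⟩, fun φ D hD => ?_⟩
  · refine norm_charDual_sub_lt_two _ _ _ ?_
    rintro _ ⟨f, rfl⟩
    refine (SignedDisc.norm_sub_le_of_mem_exprAlgebra f.2).trans ?_
    exact (SignedDisc.norm_gelfandTransform f).ge
  · refine pointDerivation_eq_zero_of_exists_sqrt p q φ (DFunLike.ne_iff.1 hpq) ?_ D hD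
    rintro ⟨_, f, rfl⟩ hpf hqf
    obtain ⟨g, hg, hgf⟩ := SignedDisc.exists_sqrt_mem_exprAlgebra f.2 hpf hqf
    refine ⟨⟨_, ⟨⟨g, hg⟩, rfl⟩⟩, Subtype.ext ?_⟩
    have hsq : (⟨g, hg⟩ : SignedDisc.exprAlgebra) * ⟨g, hg⟩ = f := Subtype.ext hgf
    exact (map_mul (gelfandTransform ℂ SignedDisc.exprAlgebra) _ _).symm.trans
      (congrArg _ hsq)

end
end

section
/- Let A be a uniform algebra on a compact Hausdorff space X and let x ∈ X. If A has bounded relative units at x, then x is a generalized peak point for A and A is strongly regular at x. -/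
open WeakDual Topology

set_option synthInstance.maxHeartbeats 400000
set_option maxHeartbeats 1000000
set_option linter.unusedSectionVars false

noncomputable section

variable {X : Type*} [TopologicalSpace X]

variable [CompactSpace X]

theorem continuous_evalChar (A : Subalgebra ℂ C(X, ℂ)) :
    Continuous (evalChar A) := by
  refine Continuous.subtype_mk (WeakDual.continuous_of_continuous_eval fun f => ?_) _
  exact (f : C(X, ℂ)).continuous

theorem eventually_eq_zero_of_mem_vanishNearSet {A : Subalgebra ℂ C(X, ℂ)}
    {x : X} {f : A} (hf : f ∈ vanishNearSet A (evalChar A x)) :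
    ∀ᶠ y in 𝓝 x, (f : C(X, ℂ)) y = 0 := by
  obtain ⟨U, hU, hfU⟩ := hf
  filter_upwards [(continuous_evalChar A).continuousAt hU] with y hy
  exact hfU _ hy

theorem mul_mem_vanishNearSet {A : Subalgebra ℂ C(X, ℂ)} {φ : characterSpace ℂ A} (g : A) {f : A}
    (hf : f ∈ vanishNearSet A φ) : g * f ∈ vanishNearSet A φ := by
  obtain ⟨U, hU, hfU⟩ := hf
  exact ⟨U, hU, fun ψ hψ => by rw [map_mul, hfU ψ hψ, mul_zero]⟩

theorem HasBoundedRelativeUnits.stronglyRegularAt {A : Subalgebra ℂ C(X, ℂ)}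
    {x : X} (h : HasBoundedRelativeUnits A x) : StronglyRegularAt A x := by
  obtain ⟨C, hC, h⟩ := h
  intro f hf
  have hf : (f : C(X, ℂ)) x = 0 := hf
  refine Metric.mem_closure_iff.2 fun ε hε => ?_
  set δ := ε / (2 * (1 + C)) with hδ
  have hδ0 : 0 < δ := by positivity
  obtain ⟨e, heJ, heK, heC⟩ := h {y | δ ≤ ‖(f : C(X, ℂ)) y‖}
    (isClosed_le continuous_const (f : C(X, ℂ)).continuous.norm).isCompact
    (by simpa [hf] using hδ0)
  refine ⟨f * e, mul_mem_vanishNearSet f heJ, ?_⟩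
  have hle : dist (f : C(X, ℂ)) ((f * e : A) : C(X, ℂ)) ≤ ε / 2 := by
    refine (ContinuousMap.dist_le (by positivity)).2 fun y => ?_
    have hfe : (f : C(X, ℂ)) y - ((f * e : A) : C(X, ℂ)) y
        = (f : C(X, ℂ)) y * (1 - (e : C(X, ℂ)) y) := by
      simp [mul_sub]
    rw [dist_eq_norm, hfe, norm_mul]
    by_cases hy : δ ≤ ‖(f : C(X, ℂ)) y‖
    · rw [heK y hy]
      simp only [sub_self, norm_zero, mul_zero]
      positivity
    · have he : ‖1 - (e : C(X, ℂ)) y‖ ≤ 1 + C := by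
        refine (norm_sub_le _ _).trans ?_
        rw [norm_one]
        exact add_le_add_right (((e : C(X, ℂ)).norm_coe_le_norm y).trans heC) 1
      calc ‖(f : C(X, ℂ)) y‖ * ‖1 - (e : C(X, ℂ)) y‖ ≤ δ * (1 + C) :=
            mul_le_mul (not_le.1 hy).le he (norm_nonneg _) hδ0.le
        _ = ε / 2 := by rw [hδ]; field_simp
  exact hle.trans_lt (by linarith)

/-- Bounded relative units give functions of bounded norm that are `1` near `x` and vanish on a
prescribed set staying away from `x`. -/
theorem HasBoundedRelativeUnits.exists_eventually_eq_one
    {A : Subalgebra ℂ C(X, ℂ)} {x : X} (h : HasBoundedRelativeUnits A x) :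
    ∃ M : ℝ, 1 < M ∧ ∀ s : Set X, sᶜ ∈ 𝓝 x → ∃ g ∈ A,
      (∀ᶠ y in 𝓝 x, g y = 1) ∧ (∀ y ∈ s, g y = 0) ∧ ‖g‖ ≤ M := by
  obtain ⟨C, hC, h⟩ := h
  refine ⟨1 + C, by linarith, fun s hs => ?_⟩
  obtain ⟨e, heJ, heK, heC⟩ := h (closure s) isClosed_closure.isCompact
    (by rwa [← Set.mem_compl_iff, ← interior_compl, mem_interior_iff_mem_nhds])
  refine ⟨1 - e, sub_mem (one_mem A) e.2, ?_, fun y hy => ?_, ?_⟩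
  · filter_upwards [eventually_eq_zero_of_mem_vanishNearSet heJ] with y hy
    simp [hy]
  · simp [heK y (subset_closure hy)]
  · refine (ContinuousMap.norm_le _ (by positivity)).2 fun y => (norm_sub_le _ _).trans ?_
    rw [ContinuousMap.one_apply, norm_one]
    exact add_le_add_right (((e : C(X, ℂ)).norm_coe_le_norm y).trans heC) 1

/-- If `a` is a sequence bounded by `M` which is constantly `1` until a single possible exception
and vanishes afterwards, then its geometric partial averages with ratio `1 - M⁻¹` have
modulus at most `1`. -/
theorem norm_sum_geometric_le_one {M : ℝ} (hM : 1 < M) {a : ℕ → ℂ} (haM : ∀ n, ‖a n‖ ≤ M)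
    (ha : ∀ n, a n ≠ 1 → a (n + 1) = 0) (n : ℕ) :
    ‖∑ i ∈ Finset.range n, ((M⁻¹ * (1 - M⁻¹) ^ i : ℝ) : ℂ) * a i‖ ≤ 1 := by
  have hM0 : 0 < M := by linarith
  have hr : 0 ≤ 1 - M⁻¹ := sub_nonneg.2 (inv_le_one_of_one_le₀ hM.le)
  have hw (i : ℕ) : ‖((M⁻¹ * (1 - M⁻¹) ^ i : ℝ) : ℂ)‖ = M⁻¹ * (1 - M⁻¹) ^ i := by
    rw [Complex.norm_real, Real.norm_of_nonneg (by positivity)]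
  have key : ‖∑ i ∈ Finset.range n, ((M⁻¹ * (1 - M⁻¹) ^ i : ℝ) : ℂ) * a i‖ ≤ 1 - (1 - M⁻¹) ^ n ∨
      (a n = 0 ∧ ‖∑ i ∈ Finset.range n, ((M⁻¹ * (1 - M⁻¹) ^ i : ℝ) : ℂ) * a i‖ ≤ 1) := by
    induction n with
    | zero => simp
    | succ n ih =>
      rw [Finset.sum_range_succ]
      rcases ih with ih | ⟨h0, ih⟩
      · by_cases h1 : a n = 1
        · left
          refine (norm_add_le _ _).trans ?_
          rw [norm_mul, hw, h1, norm_one, pow_succ]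
          linarith
        · refine Or.inr ⟨ha n h1, (norm_add_le _ _).trans ?_⟩
          rw [norm_mul, hw]
          have hb : M⁻¹ * (1 - M⁻¹) ^ n * ‖a n‖ ≤ M⁻¹ * (1 - M⁻¹) ^ n * M :=
            mul_le_mul_of_nonneg_left (haM n) (by positivity)
          have hc : M⁻¹ * (1 - M⁻¹) ^ n * M = (1 - M⁻¹) ^ n := by
            field_simp
          linarith
      · refine Or.inr ⟨ha n (by simp [h0]), ?_⟩
        simpa [h0] using ih
  rcases key with key | key
  · linarith [pow_nonneg hr n]
  · exact key.2

theorem HasBoundedRelativeUnits.isGeneralizedPeakPoint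
    {A : Subalgebra ℂ C(X, ℂ)} (hA : IsClosed (A : Set C(X, ℂ))) {x : X}
    (h : HasBoundedRelativeUnits A x) : IsGeneralizedPeakPoint A x := by
  obtain ⟨M, hM, h⟩ := h.exists_eventually_eq_one
  intro U hU
  have hM0 : 0 < M := by linarith
  have hr : 0 ≤ 1 - M⁻¹ := sub_nonneg.2 (inv_le_one_of_one_le₀ hM.le)
  have hr1 : 1 - M⁻¹ < 1 := by linarith [inv_pos.2 hM0]
  let P (g : C(X, ℂ)) : Prop := g ∈ A ∧ (∀ᶠ y in 𝓝 x, g y = 1) ∧ ‖g‖ ≤ M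
  have hstep (g : {g // P g}) : ∃ g' : {g // P g}, ∀ y, g.1 y ≠ 1 → g'.1 y = 0 := by
    obtain ⟨g', hA', h1, h0, hn⟩ := h {y | g.1 y ≠ 1} (by
      filter_upwards [g.2.2.1] with y hy
      simpa using hy)
    exact ⟨⟨g', hA', h1, hn⟩, h0⟩
  choose succ hsucc using hstep
  obtain ⟨g₀, hgA, hg1, hg0, hgn⟩ := h Uᶜ (by rwa [compl_compl])
  let g (n : ℕ) : {g // P g} := Nat.rec ⟨g₀, hgA, hg1, hgn⟩ (fun _ => succ) n
  have hgs (n : ℕ) (y : X) : (g n).1 y ≠ 1 → (g (n + 1)).1 y = 0 := hsucc (g n) y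
  have hgx (n : ℕ) : (g n).1 x = 1 := (g n).2.2.1.self_of_nhds
  have hgU (n : ℕ) (y : X) (hy : y ∉ U) : (g n).1 y = 0 := by
    induction n with
    | zero => exact hg0 y hy
    | succ n ih => exact hgs n y (by simp [ih])
  let c (i : ℕ) : ℝ := M⁻¹ * (1 - M⁻¹) ^ i
  have hc0 (i : ℕ) : 0 ≤ c i := by positivity
  have hcsum : HasSum c 1 := by
    have := (hasSum_geometric_of_lt_one hr hr1).mul_left M⁻¹
    rwa [sub_sub_cancel, inv_inv, inv_mul_cancel₀ hM0.ne'] at this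
  have hsummable : Summable fun i => (c i : ℂ) • (g i).1 := by
    refine Summable.of_norm_bounded (hcsum.summable.mul_right M) fun i => ?_
    rw [norm_smul, Complex.norm_real, Real.norm_of_nonneg (hc0 i)]
    exact mul_le_mul_of_nonneg_left (g i).2.2.2 (hc0 i)
  obtain ⟨f, hf⟩ := hsummable
  have hfy (y : X) : HasSum (fun i => (c i : ℂ) * (g i).1 y) (f y) :=
    ContinuousMap.hasSum_apply hf y
  have hfx : f x = 1 := by
    refine (hfy x).unique ?_
    simpa [hgx] using Complex.hasSum_ofReal.2 hcsum
  have hfle : ‖f‖ ≤ 1 := by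
    refine (ContinuousMap.norm_le _ zero_le_one).2 fun y => ?_
    exact le_of_tendsto' (hfy y).tendsto_sum_nat.norm fun n =>
      norm_sum_geometric_le_one hM
        (fun i => ((g i).1.norm_coe_le_norm y).trans (g i).2.2.2) (fun i => hgs i y) n
  refine ⟨f, ?_, hfx, le_antisymm hfle ?_, fun y hy => ?_⟩
  · exact hA.mem_of_tendsto hf.tendsto_sum_nat
      (Filter.Eventually.of_forall fun n => sum_mem fun i _ => A.smul_mem (g i).2.1 _)
  · simpa [hfx] using f.norm_coe_le_norm x
  · have : f y = 0 := (hfy y).unique (by simp [hgU _ y hy])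
    simp [this]

/-- If a uniform algebra `A` has bounded relative units at `x`, then `x`
is a generalized peak point for `A` and `A` is strongly regular at `x`. -/
theorem isGeneralizedPeakPoint_and_stronglyRegularAt_of_hasBoundedRelativeUnits
    {X : Type*} [TopologicalSpace X] [CompactSpace X] [T2Space X]
    (A : Subalgebra ℂ C(X, ℂ)) (hA : IsUniformAlgebra A) (x : X)
    (h : HasBoundedRelativeUnits A x) :
    IsGeneralizedPeakPoint A x ∧ StronglyRegularAt A x :=
  ⟨h.isGeneralizedPeakPoint hA.1, h.stronglyRegularAt⟩

end
end

section
/- Let A be a uniform algebra on a compact Hausdorff space Y and let y ∈ Y. Suppose that for each compact subset E of Y∖{y} there exist an open neighborhood U of y and f ∈ A such that (i) f = 1 on U, (ii) f = 0 on E, and (iii) for each k ∈ ℕ there is g ∈ A with g^(2^k) = f. Then A has bounded relative units at y. -/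
open WeakDual Topology

set_option synthInstance.maxHeartbeats 400000
set_option maxHeartbeats 1000000
set_option linter.unusedSectionVars false

noncomputable section

variable {X : Type*} [TopologicalSpace X]

variable [CompactSpace X]

/-- If every closed set missing `y` is annihilated by an element of `A` that does not vanish
at `y`, then a function in `A` vanishing near `y` in `X` has a Gelfand transform vanishing
near `y` in the maximal ideal space. -/
theorem mem_vanishNearSet_of_eventually_eq_zero (A : Subalgebra ℂ C(X, ℂ)) (y : X)
    (h : ∀ E : Set X, IsClosed E → y ∉ E → ∃ q ∈ A, q y ≠ 0 ∧ ∀ z ∈ E, q z = 0)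
    (f : A) (hf : ∀ᶠ z in 𝓝 y, (f : C(X, ℂ)) z = 0) :
    f ∈ vanishNearSet A (evalChar A y) := by
  obtain ⟨U, hU, hUo, hyU⟩ := eventually_nhds_iff.mp hf
  obtain ⟨q, hqA, hqy, hq⟩ := h Uᶜ hUo.isClosed_compl (fun hy => hy hyU)
  have hmul : f * ⟨q, hqA⟩ = 0 := by
    ext z
    by_cases hz : z ∈ U
    · simp [hU z hz]
    · simp [hq z hz]
  have hcont : Continuous fun ψ : characterSpace ℂ A => ψ (⟨q, hqA⟩ : A) :=
    (WeakDual.eval_continuous (⟨q, hqA⟩ : A)).comp continuous_subtype_val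
  refine ⟨{ψ | ψ (⟨q, hqA⟩ : A) ≠ 0},
    (isOpen_ne.preimage hcont).mem_nhds (show evalChar A y ⟨q, hqA⟩ ≠ 0 from hqy),
    fun ψ hψ => ?_⟩
  have hprod : ψ f * ψ (⟨q, hqA⟩ : A) = 0 := by
    rw [← map_mul, hmul, map_zero]
  exact (mul_eq_zero.mp hprod).resolve_right hψ

/-- A continuous function with values among the `n`-th roots of unity near `y` is constant
near `y`. -/
theorem eventually_eq_of_eventually_pow_eq_one {f : X → ℂ} {y : X} {n : ℕ} (hn : 0 < n)
    (hf : ContinuousAt f y) (hpow : ∀ᶠ z in 𝓝 y, f z ^ n = 1) :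
    ∀ᶠ z in 𝓝 y, f z = f y := by
  have hfin : {w : ℂ | w ^ n = 1}.Finite := by
    refine (Polynomial.nthRootsFinset n (1 : ℂ)).finite_toSet.subset fun w hw => ?_
    exact (Polynomial.mem_nthRootsFinset hn 1).mpr hw
  have hclosed : IsClosed ({w : ℂ | w ^ n = 1} \ {f y}) := hfin.sdiff.isClosed
  have hev : ∀ᶠ z in 𝓝 y, f z ∈ ({w : ℂ | w ^ n = 1} \ {f y})ᶜ :=
    hf (hclosed.isOpen_compl.mem_nhds fun hy => hy.2 rfl)
  filter_upwards [hpow, hev] with z hz hz'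
  by_contra hne
  exact hz' ⟨hz, hne⟩

/-- Feinstein--Heath. If for every compact `E ⊆ Y \\ {y}` there are an
open neighborhood `U` of `y` and `f ∈ A` with `f = 1` on `U`, `f = 0` on `E`, and `f`
having `2^k`-th roots in `A` for every `k`, then `A` has bounded relative units at `y`. -/
theorem hasBoundedRelativeUnits_of_roots
    {Y : Type*} [TopologicalSpace Y] [CompactSpace Y] [T2Space Y]
    (A : Subalgebra ℂ C(Y, ℂ)) (hA : IsUniformAlgebra A) (y : Y)
    (h : ∀ E : Set Y, IsCompact E → y ∉ E →
      ∃ U : Set Y, IsOpen U ∧ y ∈ U ∧ ∃ f ∈ A,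
        (∀ z ∈ U, f z = 1) ∧ (∀ z ∈ E, f z = 0) ∧
        ∀ k : ℕ, ∃ g ∈ A, g ^ (2 ^ k) = f) :
    HasBoundedRelativeUnits A y := by
  refine ⟨3, by norm_num, fun K hK hyK => ?_⟩
  obtain ⟨U, hUo, hyU, f, -, hf1, hf0, hroot⟩ := h K hK hyK
  obtain ⟨k, hk⟩ : ∃ k : ℕ, ‖f‖ ≤ 2 ^ 2 ^ k := by
    obtain ⟨k, hk⟩ := pow_unbounded_of_one_lt ‖f‖ (one_lt_two : (1 : ℝ) < 2)
    exact ⟨k, hk.le.trans (pow_le_pow_right₀ one_le_two Nat.lt_two_pow_self.le)⟩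
  obtain ⟨g, hgA, hg⟩ := hroot k
  have hn : 2 ^ k ≠ 0 := by positivity
  have hpow : ∀ z, g z ^ 2 ^ k = f z := fun z => by rw [← hg, ContinuousMap.pow_apply]
  have hgy : ‖g y‖ = 1 := Complex.norm_eq_one_of_pow_eq_one ((hpow y).trans (hf1 y hyU)) hn
  have hgy0 : g y ≠ 0 := norm_ne_zero_iff.mp (by rw [hgy]; exact one_ne_zero)
  have hg2 : ‖g‖ ≤ 2 := by
    refine (ContinuousMap.norm_le g zero_le_two).mpr fun z => ?_
    refine le_of_pow_le_pow_left₀ hn zero_le_two ?_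
    rw [← norm_pow, hpow]
    exact (f.norm_coe_le_norm z).trans hk
  refine ⟨1 - (g y)⁻¹ • (⟨g, hgA⟩ : A), ?_, fun z hz => ?_, ?_⟩
  · refine mem_vanishNearSet_of_eventually_eq_zero A y (fun E hE hyE => ?_) _ ?_
    · obtain ⟨V, -, hyV, q, hqA, hq1, hq0, -⟩ := h E hE.isCompact hyE
      exact ⟨q, hqA, by simp [hq1 y hyV], hq0⟩
    · have hU : ∀ᶠ z in 𝓝 y, g z ^ 2 ^ k = 1 := by
        filter_upwards [hUo.mem_nhds hyU] with z hz
        rw [hpow, hf1 z hz]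
      filter_upwards [eventually_eq_of_eventually_pow_eq_one (Nat.pos_of_ne_zero hn)
        g.continuous.continuousAt hU] with z hz
      simp [hz, hgy0]
  · have hgz : g z = 0 := eq_zero_of_pow_eq_zero ((hpow z).trans (hf0 z hz))
    simp [hgz]
  · refine (ContinuousMap.norm_le _ (by norm_num)).mpr fun z => ?_
    calc ‖1 - (g y)⁻¹ * g z‖ ≤ ‖(1 : ℂ)‖ + ‖(g y)⁻¹ * g z‖ := norm_sub_le _ _
      _ = 1 + ‖g z‖ := by rw [norm_mul, norm_inv, hgy, inv_one, one_mul, norm_one]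
      _ ≤ 1 + 2 := by gcongr; exact (g.norm_coe_le_norm z).trans hg2
      _ = 3 := by norm_num

end
end

section
/- Let A be a normal uniform algebra on a compact Hausdorff space X, and let d = (d^(k))_{k=0}^n be a point derivation of order n, with 1 ≤ n ≤ ∞, on A at a character φ. Then ker d is a local, primary ideal; that is, ker d is contained in a unique maximal ideal of A (namely M_φ) and J_φ ⊆ ker d. -/
open WeakDual Topology

set_option synthInstance.maxHeartbeats 400000
set_option maxHeartbeats 1000000
set_option linter.unusedSectionVars false

noncomputable section

variable {X : Type*} [TopologicalSpace X]

variable [CompactSpace X]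

/-- In a normal algebra, a point can be separated from the complement of a neighborhood by an
element which is `1` near the point. -/
theorem IsNormalOn.exists_eq_one_near [T2Space X] {A : Subalgebra ℂ C(X, ℂ)}
    (hnormal : IsNormalOn A) {x : X} {U : Set X} (hU : U ∈ 𝓝 x) :
    ∃ h : A, (∀ y ∉ U, (h : C(X, ℂ)) y = 0) ∧ ∀ᶠ y in 𝓝 x, (h : C(X, ℂ)) y = 1 := by
  obtain ⟨K, hK, hKc, hKU⟩ := exists_mem_nhds_isClosed_subset (interior_mem_nhds.2 hU)
  obtain ⟨f, hfA, hf0, hf1⟩ := hnormal (interior U)ᶜ K isOpen_interior.isClosed_compl hKc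
    (Set.disjoint_left.2 fun y hy hyK => hy (hKU hyK))
  exact ⟨⟨f, hfA⟩, fun y hy => hf0 y fun h => hy (interior_subset h),
    Filter.mem_of_superset hK fun y hy => hf1 y hy⟩

/-- Every character of a normal algebra has a support point in `X`. -/
theorem IsNormalOn.exists_support_point [T2Space X] {A : Subalgebra ℂ C(X, ℂ)}
    (hnormal : IsNormalOn A) (φ : characterSpace ℂ A) :
    ∃ x : X, ∀ U ∈ 𝓝 x, ∃ f : A, (∀ y ∉ U, (f : C(X, ℂ)) y = 0) ∧ φ f ≠ 0 := by
  classical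
  by_contra! hcon
  choose U hU hφ using hcon
  choose h h0 h1 using fun x => hnormal.exists_eq_one_near (hU x)
  obtain ⟨t, -, ht⟩ := isCompact_univ.elim_nhds_subcover
    (fun x => {y | (h x : C(X, ℂ)) y = 1}) fun x _ => h1 x
  have hprod : ∏ x ∈ t, (1 - h x) = 0 := by
    apply Subtype.ext
    ext y
    obtain ⟨x, hxt, hx⟩ := Set.mem_iUnion₂.1 (ht (Set.mem_univ y))
    have hx : (h x : C(X, ℂ)) y = 1 := hx
    rw [← Finset.mul_prod_erase t _ hxt]
    simp [hx]
  have hone := map_prod φ (fun x => 1 - h x) t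
  rw [hprod] at hone
  simp [hφ _ _ (h0 _)] at hone

/-- A normal algebra is natural: every character is evaluation at a point of `X`. -/
theorem IsNormalOn.exists_forall_apply_eq [T2Space X] {A : Subalgebra ℂ C(X, ℂ)}
    (hnormal : IsNormalOn A) (φ : characterSpace ℂ A) :
    ∃ x : X, ∀ f : A, φ f = (f : C(X, ℂ)) x := by
  obtain ⟨x, hx⟩ := hnormal.exists_support_point φ
  have hlocal (f : A) (hf : ∀ᶠ y in 𝓝 x, (f : C(X, ℂ)) y = 0) : φ f = 0 := by
    obtain ⟨g, hg0, hg⟩ := hx _ hf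
    have hfg : f * g = 0 := by
      apply Subtype.ext
      ext y
      by_cases hy : (f : C(X, ℂ)) y = 0
      · simp [hy]
      · simp [hg0 y hy]
    have := map_mul φ f g
    rw [hfg, map_zero] at this
    exact (mul_eq_zero.1 this.symm).resolve_right hg
  have hvanish (f : A) (hf : (f : C(X, ℂ)) x = 0) : φ f = 0 := by
    by_contra hc
    have hc' : 0 < ‖φ f‖ := norm_pos_iff.2 hc
    have hU : {y | ‖(f : C(X, ℂ)) y‖ < ‖φ f‖ / 2} ∈ 𝓝 x := by
      apply (isOpen_lt (by fun_prop) continuous_const).mem_nhds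
      simpa [hf] using hc'
    obtain ⟨h, h0, h1⟩ := hnormal.exists_eq_one_near hU
    have hφh : φ h = 1 := by
      have := hlocal (1 - h) (h1.mono fun y hy => by simp [hy])
      rw [map_sub, map_one, sub_eq_zero] at this
      exact this.symm
    have hbound (m : ℕ) : ‖f ^ m * h‖ ≤ (‖φ f‖ / 2) ^ m * ‖h‖ := by
      change ‖((f ^ m * h : A) : C(X, ℂ))‖ ≤ _
      refine (ContinuousMap.norm_le _ (by positivity)).2 fun y => ?_
      by_cases hy : ‖(f : C(X, ℂ)) y‖ < ‖φ f‖ / 2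
      · simp only [MulMemClass.coe_mul, SubmonoidClass.coe_pow, ContinuousMap.mul_apply,
          ContinuousMap.pow_apply, norm_mul, norm_pow]
        exact mul_le_mul (pow_le_pow_left₀ (norm_nonneg _) hy.le m)
          ((h : C(X, ℂ)).norm_coe_le_norm y) (norm_nonneg _) (by positivity)
      · simp only [MulMemClass.coe_mul, ContinuousMap.mul_apply, h0 y hy, mul_zero, norm_zero]
        positivity
    have hle (m : ℕ) : (2 : ℝ) ^ m ≤ ‖charDual φ‖ * ‖h‖ := by
      have key : ‖φ (f ^ m * h)‖ ≤ ‖charDual φ‖ * ‖f ^ m * h‖ := (charDual φ).le_opNorm _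
      rw [map_mul, map_pow, hφh, mul_one, norm_pow] at key
      have key' := key.trans (mul_le_mul_of_nonneg_left (hbound m) (charDual φ).opNorm_nonneg)
      have hpos : 0 < (‖φ f‖ / 2) ^ m := by positivity
      have hsplit : ‖φ f‖ ^ m = 2 ^ m * (‖φ f‖ / 2) ^ m := by
        rw [← mul_pow]
        congr 1
        ring
      refine le_of_mul_le_mul_right ?_ hpos
      linarith
    obtain ⟨m, hm⟩ := pow_unbounded_of_one_lt (‖charDual φ‖ * ‖h‖) one_lt_two
    exact (hle m).not_gt hm
  refine ⟨x, fun f => ?_⟩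
  have := hvanish (f - algebraMap ℂ A ((f : C(X, ℂ)) x)) (by simp)
  rwa [map_sub, AlgHomClass.commutes, sub_eq_zero] at this

/-- If `f * h = 0` with `φ h ≠ 0`, every term of a point derivation at `φ` kills `f`. -/
theorem IsDerivSeq.apply_eq_zero_of_mul_eq_zero {A : Type*} [MulZeroClass A] {φ : A → ℂ}
    {n : ℕ∞} {d : ℕ → A → ℂ} (hd : IsDerivSeq φ n d) (hd0 : ∀ k, d k 0 = 0) {f h : A}
    (hfh : f * h = 0) (hh : φ h ≠ 0) (hf : φ f = 0) (k : ℕ) (hk : (k : ℕ∞) ≤ n) :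
    d k f = 0 := by
  induction k using Nat.strong_induction_on with
  | _ k ih =>
    rcases Nat.eq_zero_or_pos k with rfl | hpos
    · rw [hd.1, hf]
    · have hL := hd.2 k hpos hk f h
      rw [hfh, hd0, Finset.sum_range_succ, Finset.sum_eq_zero, zero_add, Nat.sub_self,
        hd.1 h] at hL
      · exact (mul_eq_zero.1 hL.symm).resolve_right hh
      · intro j hj
        have hjk := Finset.mem_range.1 hj
        rw [ih j hjk ((Nat.cast_le.2 hjk.le).trans hk), zero_mul]

/-- The kernel of a point derivation of order `n` (`1 ≤ n ≤ ∞`) on a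
normal uniform algebra is a local, primary ideal: it is an ideal contained in the kernel
of exactly one character (namely `φ`), and it contains `J_φ`. -/
theorem kernel_of_point_derivation_local_primary
    {X : Type*} [TopologicalSpace X] [CompactSpace X] [T2Space X]
    (A : Subalgebra ℂ C(X, ℂ)) (hA : IsUniformAlgebra A) (hnormal : IsNormalOn A)
    (φ : characterSpace ℂ A) (n : ℕ∞) (hn : 1 ≤ n)
    (d : ℕ → (A →ₗ[ℂ] ℂ)) (hd : IsDerivSeq (fun f => φ f) n (fun k f => d k f)) :
    (∃ I : Ideal A, (I : Set A) = {f : A | ∀ k : ℕ, (k : ℕ∞) ≤ n → d k f = 0}) ∧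
    (∀ f : A, (∀ k : ℕ, (k : ℕ∞) ≤ n → d k f = 0) → φ f = 0) ∧
    (∀ ψ : characterSpace ℂ A,
      (∀ f : A, (∀ k : ℕ, (k : ℕ∞) ≤ n → d k f = 0) → ψ f = 0) → ψ = φ) ∧
    (∀ f ∈ vanishNearSet A φ, ∀ k : ℕ, (k : ℕ∞) ≤ n → d k f = 0) := by
  obtain ⟨x, hx⟩ := hnormal.exists_forall_apply_eq φ
  have hlocal (f : A) (hf : ∀ᶠ y in 𝓝 x, (f : C(X, ℂ)) y = 0) (k : ℕ) (hk : (k : ℕ∞) ≤ n) :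
      d k f = 0 := by
    obtain ⟨h, h0, h1⟩ := hnormal.exists_eq_one_near hf
    refine hd.apply_eq_zero_of_mul_eq_zero (fun k => map_zero (d k)) (h := h) ?_ ?_ ?_ k hk
    · apply Subtype.ext
      ext y
      by_cases hy : (f : C(X, ℂ)) y = 0
      · simp [hy]
      · simp [h0 y hy]
    · simp [hx, h1.self_of_nhds]
    · simp [hx, hf.self_of_nhds]
  refine ⟨⟨{ carrier := {f : A | ∀ k : ℕ, (k : ℕ∞) ≤ n → d k f = 0}
             add_mem' := fun ha hb k hk => by rw [map_add, ha k hk, hb k hk, add_zero]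
             zero_mem' := fun k _ => map_zero _
             smul_mem' := fun c f hf k hk => ?_ }, rfl⟩, fun f hf => ?_, fun ψ hψ => ?_,
    fun f ⟨U, hU, hf⟩ => hlocal f ?_⟩
  · rw [smul_eq_mul]
    rcases Nat.eq_zero_or_pos k with rfl | hpos
    · have hf0 : φ f = 0 := (hd.1 f).symm.trans (hf 0 hk)
      refine (hd.1 (c * f)).trans ?_
      simp [hf0]
    · refine (hd.2 k hpos hk c f).trans (Finset.sum_eq_zero fun j _ => ?_)
      exact mul_eq_zero_of_right _ (hf (k - j) ((Nat.cast_le.2 (Nat.sub_le k j)).trans hk))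
  · exact (hd.1 f).symm.trans (hf 0 (by simp))
  · obtain ⟨y, hy⟩ := hnormal.exists_forall_apply_eq ψ
    suffices hyx : y = x by
      subst hyx
      exact DFunLike.ext _ _ fun f => (hy f).trans (hx f).symm
    by_contra hyx
    obtain ⟨h, h0, h1⟩ := hnormal.exists_eq_one_near
      (isOpen_compl_singleton.mem_nhds (show x ∈ ({y} : Set X)ᶜ from fun h => hyx h.symm))
    have h1h : ψ (1 - h) = 0 := hψ _ (hlocal _ (h1.mono fun z hz => by simp [hz]))
    rw [map_sub, map_one, hy, h0 y (by simp)] at h1h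
    simp at h1h
  · have hφ : φ = evalChar A x := DFunLike.ext _ _ hx
    rw [hφ] at hU
    exact Filter.mem_of_superset ((continuous_evalChar A).continuousAt hU) fun y hy => hf _ hy

end
end
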